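/- Let r ≥ 2 and let G be an infinite polycyclic group with a subnormal series G = G_1 ⊳ G_2 ⊳ … ⊳ G_{r+1} = {e}, where each G_{i+1} is normal in G_i and each quotient G_i/G_{i+1} is cyclic. For each i let a_i ∈ G_i be an element whose image generates G_i/G_{i+1}, let π : F_r → G be the (surjective) homomorphism with π(s_i) = a_i, and let N = ker π. Assume G has polynomial volume growth of degree D. Let μ be the lazy simple random walk measure on Γ_2(N) = F_r/[N,N]. Then there exists a constant C ≥ 1 such that for all n ≥ 2: exp(−C·n^{D/(2+D)}·(log n)^{2/(2+D)}) ≤ μ^{(2n)}(e) ≤ exp(−(1/C)·n^{D/(2+D)}·(log n)^{2/(2+D)}). -/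

import Mathlib

open scoped Pointwise

noncomputable section

open Classical in
/-- Convolution of two real-valued functions ("measures") on a group:
`(μ ∗ ν)(g) = Σ_h μ(h) ν(h⁻¹ g)`. -/
noncomputable def conv {G : Type*} [Group G] (μ ν : G → ℝ) : G → ℝ :=
  fun g => ∑' h : G, μ h * ν (h⁻¹ * g)

open Classical in
/-- `convPow μ n` is the `n`-fold convolution power of `μ`;
`convPow μ 0` is the Dirac mass at the identity. -/
noncomputable def convPow {G : Type*} [Group G] (μ : G → ℝ) : ℕ → G → ℝ
  | 0 => fun g => if g = 1 then 1 else 0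
  | n + 1 => conv μ (convPow μ n)

/-- Pushforward of a measure along a map. -/
noncomputable def pushforward {G H : Type*} (f : G → H) (μ : G → ℝ) : H → ℝ :=
  fun h => ∑' g : {g : G // f g = h}, μ g.1

open Classical in
/-- The lazy simple random walk measure on the free group on `r` generators:
mass `1/2` at the identity and mass `1/(4r)` at each `sᵢ^{±1}`. -/
noncomputable def lazySRW (r : ℕ) : FreeGroup (Fin r) → ℝ := fun g =>
  if g = 1 then 1 / 2
  else if ∃ i : Fin r, g = FreeGroup.of i ∨ g = (FreeGroup.of i)⁻¹ then 1 / (4 * r)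
  else 0

/-- The lazy simple random walk measure on the quotient `F_r / M`, i.e. the pushforward
of `lazySRW r` under the quotient map. -/
noncomputable def lazySRWQuot (r : ℕ) (M : Subgroup (FreeGroup (Fin r))) [M.Normal] :
    FreeGroup (Fin r) ⧸ M → ℝ :=
  pushforward (QuotientGroup.mk : FreeGroup (Fin r) → FreeGroup (Fin r) ⧸ M) (lazySRW r)

/-- Iterated logarithms: `iterLog 1 x = log (1 + x)` and
`iterLog (i+1) x = log (1 + iterLog i x)`. -/
noncomputable def iterLog : ℕ → ℝ → ℝ
  | 0, x => x
  | n + 1, x => Real.log (1 + iterLog n x)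

instance derivedSeriesNormal (G : Type*) [Group G] (n : ℕ) : (derivedSeries G n).Normal :=
  derivedSeries_normal G n

/-- `G` has polynomial volume growth of degree `D`: there is a finite symmetric generating
set `S` containing the identity and constants `0 < c ≤ C` with
`c·n^D ≤ #(Sⁿ) ≤ C·n^D` for all `n ≥ 1`. -/
def HasPolyGrowth (G : Type*) [Group G] (D : ℕ) : Prop :=
  ∃ S : Set G, S.Finite ∧ (1 : G) ∈ S ∧ (∀ x ∈ S, x⁻¹ ∈ S) ∧ Subgroup.closure S = ⊤ ∧
    ∃ c C : ℝ, 0 < c ∧ c ≤ C ∧ ∀ n : ℕ, 1 ≤ n →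
      c * (n : ℝ) ^ D ≤ (Nat.card ↥(S ^ n) : ℝ) ∧ (Nat.card ↥(S ^ n) : ℝ) ≤ C * (n : ℝ) ^ D

/-- `G` has exponential volume growth: there is a finite symmetric generating set `S`
containing the identity and `c > 0` with `#(Sⁿ) ≥ e^{cn}` for all `n ≥ 1`. -/
def HasExpGrowth (G : Type*) [Group G] : Prop :=
  ∃ S : Set G, S.Finite ∧ (1 : G) ∈ S ∧ (∀ x ∈ S, x⁻¹ ∈ S) ∧ Subgroup.closure S = ⊤ ∧
    ∃ c : ℝ, 0 < c ∧ ∀ n : ℕ, 1 ≤ n → Real.exp (c * n) ≤ (Nat.card ↥(S ^ n) : ℝ)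

section part1

/-- Averaging operator of the lazy simple random walk, acting on functions on a group. -/
def avgL {r : ℕ} {Q : Type*} [Group Q] {V : Type*} [AddCommGroup V] [Module ℝ V]
    (s : Fin r → Q) : Module.End ℝ (Q → V) where
  toFun F := fun γ => (1/2 : ℝ) • F γ +
    (1/(4*r) : ℝ) • ∑ i, (F (s i * γ) + F ((s i)⁻¹ * γ))
  map_add' F F' := by
    funext γ
    simp only [Pi.add_apply, smul_add, Finset.sum_add_distrib]
    abel
  map_smul' c F := by
    funext γ
    simp only [Pi.smul_apply, RingHom.id_apply, smul_add, Finset.sum_add_distrib,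
      smul_comm _ c, Finset.smul_sum]

open Classical in
/-- Dirac function. -/
def dl {Q : Type*} (g : Q) : Q → ℝ := fun γ => if γ = g then 1 else 0

lemma lazySRW_eq (r : ℕ) (x : FreeGroup (Fin r)) :
    lazySRW r x = 1/2 * dl 1 x + 1/(4*r) * ∑ i, (dl (FreeGroup.of i) x + dl (FreeGroup.of i)⁻¹ x) := by
  have hne : ∀ i j : Fin r, FreeGroup.of i ≠ (FreeGroup.of j)⁻¹ := by
    intro i j h
    have h1 := congrArg FreeGroup.toWord h
    simp [FreeGroup.toWord_inv, FreeGroup.invRev] at h1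
  have hne1 : ∀ i : Fin r, FreeGroup.of i ≠ 1 := fun i => FreeGroup.of_ne_one i
  have hne2 : ∀ i : Fin r, (FreeGroup.of i)⁻¹ ≠ 1 := fun i => by simp
  unfold lazySRW dl
  by_cases h1 : x = 1
  · subst h1
    simp [fun i => (hne1 i).symm]
  · by_cases h2 : ∃ i : Fin r, x = FreeGroup.of i ∨ x = (FreeGroup.of i)⁻¹
    · rw [if_neg h1, if_pos h2, if_neg h1]
      obtain ⟨i, rfl | rfl⟩ := h2
      · simp [hne, FreeGroup.of_injective.eq_iff]
      · simp [fun i j => (hne i j).symm, FreeGroup.of_injective.eq_iff]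
    · rw [if_neg h1, if_neg h2, if_neg h1]
      push Not at h2
      simp [h2]

lemma hasSum_dl_fiber {X Y : Type*} (f : X → Y) (x : X) (h : Y) :
    HasSum (fun g : {g : X // f g = h} => dl x g.1) (dl (f x) h) := by
  classical
  by_cases hx : f x = h
  · have : dl (f x) h = dl x (⟨x, hx⟩ : {g : X // f g = h}).1 := by simp [dl, hx]
    rw [this]
    apply hasSum_single
    intro b hb
    have : b.1 ≠ x := fun h' => hb (Subtype.ext h')
    simp [dl, this]
  · have : dl (f x) h = 0 := by simp [dl, Ne.symm hx]
    rw [this]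
    convert hasSum_zero with b
    have : b.1 ≠ x := by rintro rfl; exact hx b.2
    simp [dl, this]

lemma lazySRWQuot_eq (r : ℕ) (M : Subgroup (FreeGroup (Fin r))) [M.Normal]
    (x : FreeGroup (Fin r) ⧸ M) :
    lazySRWQuot r M x = 1/2 * dl 1 x + 1/(4*r) * ∑ i,
      (dl (QuotientGroup.mk (FreeGroup.of i)) x + dl (QuotientGroup.mk (FreeGroup.of i))⁻¹ x) := by
  unfold lazySRWQuot pushforward
  apply HasSum.tsum_eq
  simp_rw [lazySRW_eq]
  refine HasSum.add (HasSum.mul_left _ ?_) (HasSum.mul_left _ (hasSum_sum fun i _ => HasSum.add ?_ ?_))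
  · exact hasSum_dl_fiber _ _ _
  · exact hasSum_dl_fiber _ _ _
  · exact hasSum_dl_fiber _ _ _

lemma hasSum_dl_mul {X : Type*} (x : X) (f : X → ℝ) :
    HasSum (fun g => dl x g * f g) (f x) := by
  classical
  convert hasSum_single x (f := fun g => dl x g * f g) ?_ using 1
  · simp [dl]
  · intro b hb; simp [dl, hb]

lemma convPow_succ_eq (r : ℕ) (M : Subgroup (FreeGroup (Fin r))) [M.Normal]
    (n : ℕ) (g : FreeGroup (Fin r) ⧸ M) :
    convPow (lazySRWQuot r M) (n+1) g = 1/2 * convPow (lazySRWQuot r M) n g +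
      1/(4*r) * ∑ i : Fin r, (convPow (lazySRWQuot r M) n ((QuotientGroup.mk (FreeGroup.of i))⁻¹ * g)
        + convPow (lazySRWQuot r M) n ((QuotientGroup.mk (FreeGroup.of i)) * g)) := by
  show conv _ _ _ = _
  unfold conv
  apply HasSum.tsum_eq
  generalize convPow (lazySRWQuot r M) n = ν
  simp_rw [lazySRWQuot_eq, add_mul, mul_assoc, Finset.sum_mul, add_mul]
  refine HasSum.add (HasSum.mul_left _ ?_) (HasSum.mul_left _ (hasSum_sum fun i _ => HasSum.add ?_ ?_))
  · simpa using hasSum_dl_mul (1 : FreeGroup (Fin r) ⧸ M) (fun h => ν (h⁻¹ * g))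
  · exact hasSum_dl_mul _ (fun h => ν (h⁻¹ * g))
  · simpa using hasSum_dl_mul (QuotientGroup.mk (FreeGroup.of i) : FreeGroup (Fin r) ⧸ M)⁻¹ (fun h => ν (h⁻¹ * g))

section
variable {r : ℕ} {Q : Type*} [Group Q] (s : Fin r → Q)

lemma avgL_apply {V : Type*} [AddCommGroup V] [Module ℝ V] (F : Q → V) (γ : Q) :
    avgL s F γ = (1/2 : ℝ) • F γ + (1/(4*r) : ℝ) • ∑ i, (F (s i * γ) + F ((s i)⁻¹ * γ)) := rfl

lemma avgL_dl (g : Q) : avgL s (dl g) = (1/2 : ℝ) • dl g +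
    (1/(4*r) : ℝ) • ∑ i, (dl ((s i)⁻¹ * g) + dl (s i * g)) := by
  funext γ
  simp only [avgL_apply, Pi.add_apply, Pi.smul_apply, Finset.sum_apply, dl]
  congr 3
  funext i
  congr 2
  · simp [eq_inv_mul_iff_mul_eq]
  · simp [inv_mul_eq_iff_eq_mul]

lemma avgL_mono_real {F F' : Q → ℝ} (h : F ≤ F') : avgL s F ≤ avgL s F' := by
  intro γ
  simp only [avgL_apply, smul_eq_mul]
  have := h γ
  have h2 : ∑ i, (F (s i * γ) + F ((s i)⁻¹ * γ)) ≤ ∑ i, (F' (s i * γ) + F' ((s i)⁻¹ * γ)) :=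
    Finset.sum_le_sum fun i _ => add_le_add (h _) (h _)
  have h3 : (0:ℝ) ≤ 1/(4*r) := by positivity
  gcongr

lemma avgL_pow_mono {F F' : Q → ℝ} (h : F ≤ F') (n : ℕ) : ((avgL s)^n) F ≤ ((avgL s)^n) F' := by
  induction n with
  | zero => simpa using h
  | succ n ih => simp only [pow_succ', Module.End.mul_apply]; exact avgL_mono_real s ih

lemma avgL_one (hr : r ≠ 0) : avgL s (1 : Q → ℝ) = 1 := by
  funext γ
  have : (r:ℝ) ≠ 0 := by exact_mod_cast hr
  simp only [avgL_apply, smul_eq_mul, Pi.one_apply, Finset.sum_const, Finset.card_univ, Fintype.card_fin, nsmul_eq_mul]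
  field_simp; ring

lemma avgL_pow_one (hr : r ≠ 0) (n : ℕ) : ((avgL s)^n) (1 : Q → ℝ) = 1 := by
  induction n with
  | zero => simp
  | succ n ih => rw [pow_succ', Module.End.mul_apply, ih, avgL_one s hr]

lemma avgL_pow_trans {V : Type*} [AddCommGroup V] [Module ℝ V] (F : Q → V) (δ : Q) (n : ℕ) (γ : Q) :
    ((avgL s)^n) (fun x => F (x * δ)) γ = ((avgL s)^n) F (γ * δ) := by
  induction n generalizing γ with
  | zero => simp
  | succ n ih => simp only [pow_succ', Module.End.mul_apply, avgL_apply, ih, mul_assoc]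

lemma dl_nonneg {Q : Type*} (g x : Q) : 0 ≤ dl g x := by unfold dl; split_ifs <;> norm_num

lemma avgL_symm (n : ℕ) (x y : Q) : ((avgL s)^n) (dl y) x = ((avgL s)^n) (dl x) y := by
  induction n generalizing x y with
  | zero =>
    simp only [pow_zero, Module.End.one_apply, dl]
    split_ifs <;> simp_all
  | succ n ih =>
    conv_lhs => rw [pow_succ', Module.End.mul_apply, avgL_apply]
    conv_rhs => rw [pow_succ, Module.End.mul_apply, avgL_dl]
    simp only [map_add, map_smul, map_sum, Pi.add_apply, Pi.smul_apply, Finset.sum_apply]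
    simp only [ih _ y]
    congr 3
    funext i
    rw [add_comm]

lemma convPow_eq_avgL (r : ℕ) (M : Subgroup (FreeGroup (Fin r))) [M.Normal]
    (n : ℕ) (g : FreeGroup (Fin r) ⧸ M) :
    convPow (lazySRWQuot r M) n g =
      ((avgL (fun i : Fin r => (QuotientGroup.mk (FreeGroup.of i) : FreeGroup (Fin r) ⧸ M)))^n) (dl g) 1 := by
  induction n generalizing g with
  | zero =>
    simp only [convPow, pow_zero, Module.End.one_apply, dl]
    split_ifs <;> simp_all
  | succ n ih =>
    rw [convPow_succ_eq, pow_succ, Module.End.mul_apply, avgL_dl]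
    simp only [map_add, map_smul, map_sum, Pi.add_apply, Pi.smul_apply, Finset.sum_apply, ih, smul_eq_mul]

lemma dl_one_trans (x : Q) (n : ℕ) : ((avgL s)^n) (dl 1) x = ((avgL s)^n) (dl x) 1 := avgL_symm s n x 1

/-- Cauchy–Schwarz lower bound for the return probability. -/
lemma return_ge (n : ℕ) (A : Finset Q) :
    (((avgL s)^n) (fun x => open Classical in if x ∈ A then (1:ℝ) else 0) 1)^2 ≤
      A.card * ((avgL s)^(2*n)) (dl 1) 1 := by
  classical
  have h1 : (fun x => open Classical in if x ∈ A then (1:ℝ) else 0) = ∑ α ∈ A, dl α := by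
    funext x
    simp [dl, Finset.sum_apply]
  rw [h1, map_sum, Finset.sum_apply]
  refine le_trans sq_sum_le_card_mul_sum_sq ?_
  apply mul_le_mul_of_nonneg_left _ (by positivity)
  have h2 : (∑ α ∈ A, (((avgL s)^n) (dl α) 1) • dl α : Q → ℝ) ≤ ((avgL s)^n) (dl 1) := by
    intro x
    simp only [Finset.sum_apply, Pi.smul_apply, smul_eq_mul, dl]
    simp only [mul_ite, mul_one, mul_zero, Finset.sum_ite_eq]
    split_ifs
    · exact le_of_eq (dl_one_trans s x n).symm
    · have := avgL_pow_mono s (F := 0) (F' := dl (1:Q)) (fun x => dl_nonneg _ _) n x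
      simpa using this
  have h3 := avgL_pow_mono s h2 n 1
  rw [two_mul, pow_add, Module.End.mul_apply]
  refine le_trans (le_of_eq ?_) h3
  simp [map_sum, Finset.sum_apply, sq]

lemma return_pos (n : ℕ) : 0 < ((avgL s)^n) (dl (1:Q)) 1 := by
  suffices ∀ n, (1/2:ℝ)^n ≤ ((avgL s)^n) (dl (1:Q)) 1 from lt_of_lt_of_le (by positivity) (this n)
  intro n
  induction n with
  | zero => simp [dl]
  | succ n ih =>
    rw [pow_succ' (avgL s), Module.End.mul_apply, avgL_apply]
    have h : ∀ x, 0 ≤ ((avgL s)^n) (dl (1:Q)) x := fun x => by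
      simpa using avgL_pow_mono s (F := 0) (F' := dl (1:Q)) (fun x => dl_nonneg _ _) n x
    have : 0 ≤ (1/(4*r) : ℝ) • ∑ i, (((avgL s)^n) (dl (1:Q)) (s i * 1) + ((avgL s)^n) (dl (1:Q)) ((s i)⁻¹ * 1)) := by
      apply smul_nonneg (by positivity)
      exact Finset.sum_nonneg fun i _ => add_nonneg (h _) (h _)
    rw [pow_succ', smul_eq_mul]
    nlinarith

lemma return_lt_one (i : Fin r) (hi : s i ≠ 1) (n : ℕ) : ((avgL s)^(n+1)) (dl (1:Q)) 1 < 1 := by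
  have hr : r ≠ 0 := by rintro rfl; exact i.elim0
  have hle : ∀ m x, ((avgL s)^m) (dl (1:Q)) x ≤ 1 := fun m x => by
    have := avgL_pow_mono s (F := dl (1:Q)) (F' := 1) (fun x => by unfold dl; split_ifs <;> norm_num) m x
    rwa [avgL_pow_one s hr] at this
  have key : ∀ m, ((avgL s)^(m)) (dl (1:Q)) ((s i)) < 1 := by
    intro m
    induction m with
    | zero => simp [dl, hi]
    | succ m ih =>
      have h1 := congrFun (avgL_one s hr) (s i)
      rw [pow_succ', Module.End.mul_apply, ← Pi.one_apply (M := fun _ => ℝ) (s i), ← avgL_one s hr]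
      rw [avgL_apply, avgL_apply]
      apply add_lt_add_of_lt_of_le
      · simp only [smul_eq_mul, Pi.one_apply]; linarith
      · apply smul_le_smul_of_nonneg_left _ (by positivity)
        exact Finset.sum_le_sum fun j _ => add_le_add (hle _ _) (hle _ _)
  have hrp : (0:ℝ) < r := by positivity
  have h1 : ((avgL s)^(n+1)) (dl (1:Q)) 1 < avgL s (1 : Q → ℝ) 1 := by
    rw [pow_succ', Module.End.mul_apply, avgL_apply, avgL_apply]
    apply add_lt_add_of_le_of_lt
    · simp only [smul_eq_mul, Pi.one_apply]; linarith [hle n 1]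
    · apply smul_lt_smul_of_pos_left _ (by positivity)
      apply Finset.sum_lt_sum
      · exact fun j _ => add_le_add (hle _ _) (hle _ _)
      · exact ⟨i, Finset.mem_univ _, add_lt_add_of_lt_of_le (by simpa using key n) (hle _ _)⟩
  rwa [avgL_one s hr] at h1
end
end part1

section part2

section Balls
variable {r : ℕ} {G : Type*} [Group G] [DecidableEq G] (a : Fin r → G)

/-- The symmetric generating set attached to `a`. -/
def gT : Finset G :=
  insert 1 (Finset.univ.image a ∪ Finset.univ.image (fun i => (a i)⁻¹))

/-- Word balls. -/
def wBall (n : ℕ) : Finset G := (gT a)^n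

lemma one_mem_gT : (1:G) ∈ gT a := by simp [gT]

lemma gen_mem_gT (i : Fin r) : a i ∈ gT a := by simp [gT]

lemma geninv_mem_gT (i : Fin r) : (a i)⁻¹ ∈ gT a := by simp [gT]

lemma mem_gT {x : G} : x ∈ gT a ↔ x = 1 ∨ (∃ i, a i = x) ∨ ∃ i, (a i)⁻¹ = x := by
  simp [gT]

lemma gT_inv : (gT a)⁻¹ = gT a := by
  ext x
  rw [Finset.mem_inv', mem_gT, mem_gT]
  constructor
  · rintro (h | ⟨i, h⟩ | ⟨i, h⟩)
    · left; simpa using h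
    · right; right; exact ⟨i, by rw [h]; simp⟩
    · right; left; exact ⟨i, by simpa using h⟩
  · rintro (h | ⟨i, h⟩ | ⟨i, h⟩)
    · left; simpa using h
    · right; right; exact ⟨i, by rw [h]⟩
    · right; left; exact ⟨i, by rw [← h]; simp⟩

lemma wBall_zero : wBall a 0 = {1} := by simp [wBall]; rfl

lemma wBall_mono {m n : ℕ} (h : m ≤ n) : wBall a m ⊆ wBall a n :=
  Finset.pow_subset_pow_right (one_mem_gT a) h

lemma one_mem_ball (n : ℕ) : (1:G) ∈ wBall a n := Finset.one_mem_pow (one_mem_gT a)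

lemma mul_mem_ball {m n : ℕ} {x y : G} (hx : x ∈ wBall a m) (hy : y ∈ wBall a n) :
    x * y ∈ wBall a (m+n) := by
  unfold wBall at *; rw [pow_add]; exact Finset.mul_mem_mul hx hy

lemma wBall_add (m n : ℕ) : wBall a (m+n) = wBall a m * wBall a n := pow_add _ _ _

lemma wBall_mul (m n : ℕ) : wBall a (m*n) = (wBall a m)^n := pow_mul _ _ _

lemma inv_mem_ball {n : ℕ} {x : G} (hx : x ∈ wBall a n) : x⁻¹ ∈ wBall a n := by
  have : (wBall a n)⁻¹ = wBall a n := by unfold wBall; rw [← inv_pow, gT_inv]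
  rw [← this]; simpa using hx

lemma gT_subset_ball_one : gT a ⊆ wBall a 1 := by simp [wBall]

lemma gen_mul_mem {n : ℕ} {x : G} (i : Fin r) (hx : x ∈ wBall a n) : a i * x ∈ wBall a (n+1) := by
  rw [add_comm]; exact mul_mem_ball a (gT_subset_ball_one a (gen_mem_gT a i)) hx

lemma geninv_mul_mem {n : ℕ} {x : G} (i : Fin r) (hx : x ∈ wBall a n) :
    (a i)⁻¹ * x ∈ wBall a (n+1) := by
  rw [add_comm]; exact mul_mem_ball a (gT_subset_ball_one a (geninv_mem_gT a i)) hx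

lemma wBall_card_pos (n : ℕ) : 0 < (wBall a n).card := Finset.card_pos.2 ⟨1, one_mem_ball a n⟩

lemma exists_mem_ball (hgen : Subgroup.closure (Set.range a) = ⊤) (g : G) : ∃ n, g ∈ wBall a n := by
  have hg : g ∈ Subgroup.closure (Set.range a) := by rw [hgen]; trivial
  induction hg using Subgroup.closure_induction with
  | mem x hx =>
    obtain ⟨i, rfl⟩ := hx
    exact ⟨1, gT_subset_ball_one a (gen_mem_gT a i)⟩
  | one => exact ⟨0, one_mem_ball a 0⟩
  | mul x y _ _ hx hy =>
    obtain ⟨m, hm⟩ := hx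
    obtain ⟨n, hn⟩ := hy
    exact ⟨m+n, mul_mem_ball a hm hn⟩
  | inv x _ hx => obtain ⟨m, hm⟩ := hx; exact ⟨m, inv_mem_ball a hm⟩

/-- Two-sided polynomial volume bounds for the balls. -/
def VolB (D : ℕ) (c C : ℝ) : Prop :=
  0 < c ∧ 0 < C ∧ ∀ n : ℕ, 1 ≤ n → c * (n:ℝ)^D ≤ (wBall a n).card ∧ ((wBall a n).card : ℝ) ≤ C * (n:ℝ)^D

lemma exists_pow_mem {G : Type*} [Group G] {S : Set G} (hinv : ∀ x ∈ S, x⁻¹ ∈ S)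
    (hgen : Subgroup.closure S = ⊤) (g : G) : ∃ n : ℕ, g ∈ S^n := by
  have hg : g ∈ Subgroup.closure S := by rw [hgen]; trivial
  have hS : S⁻¹ = S := by
    ext x
    exact ⟨fun h => by simpa using hinv _ h, fun h => hinv _ h⟩
  induction hg using Subgroup.closure_induction with
  | mem x hx => exact ⟨1, by simpa using hx⟩
  | one => exact ⟨0, by simp⟩
  | mul x y _ _ hx hy =>
    obtain ⟨m, hm⟩ := hx
    obtain ⟨n, hn⟩ := hy
    exact ⟨m+n, by rw [pow_add]; exact Set.mul_mem_mul hm hn⟩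
  | inv x _ hx =>
    obtain ⟨m, hm⟩ := hx
    exact ⟨m, by rw [← hS, inv_pow]; simpa using hm⟩

lemma volB_of_polyGrowth (hgen : Subgroup.closure (Set.range a) = ⊤) {D : ℕ}
    (hG : HasPolyGrowth G D) : ∃ c C, VolB a D c C := by
  obtain ⟨S, hfin, h1, hinv, hgenS, c, C, hc, hcC, hb⟩ := hG
  have hx1 : ∃ k : ℕ, 1 ≤ k ∧ S ⊆ (wBall a k : Set G) := by
    choose N hN using exists_mem_ball a hgen
    refine ⟨(hfin.toFinset.sup N) + 1, by omega, fun x hx => ?_⟩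
    refine wBall_mono a ?_ (hN x)
    have : N x ≤ hfin.toFinset.sup N := Finset.le_sup (f := N) (by simpa using hx)
    omega
  have hx2 : ∃ k : ℕ, 1 ≤ k ∧ (gT a : Set G) ⊆ S^k := by
    choose N hN using exists_pow_mem hinv hgenS
    refine ⟨((gT a).sup N) + 1, by omega, fun x hx => ?_⟩
    have : N x ≤ (gT a).sup N := Finset.le_sup (f := N) (by simpa using hx)
    exact Set.pow_subset_pow_right h1 (by omega) (hN x)
  obtain ⟨k, hk, hSk⟩ := hx1
  obtain ⟨j, hj, hTj⟩ := hx2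
  have hlow : ∀ n, (Nat.card ↥(S^n)) ≤ (wBall a (k*n)).card := by
    intro n
    have : S^n ⊆ (wBall a (k*n) : Set G) := by
      rw [wBall_mul, Finset.coe_pow]; exact Set.pow_subset_pow_left hSk
    have h2 := Nat.card_mono (Finset.finite_toSet _) this
    simpa using h2
  have hup : ∀ n, (wBall a n).card ≤ (Nat.card ↥(S^(j*n))) := by
    intro n
    have : (wBall a n : Set G) ⊆ S^(j*n) := by
      rw [pow_mul, wBall, Finset.coe_pow]; exact Set.pow_subset_pow_left hTj
    have hf : (S^(j*n)).Finite := by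
      generalize j*n = N
      induction N with
      | zero => simp
      | succ N ih => rw [pow_succ]; exact ih.mul hfin
    have h2 := Nat.card_mono hf this
    simpa using h2
  have hC : 0 < C := lt_of_lt_of_le hc hcC
  have hkR : (1:ℝ) ≤ k := by exact_mod_cast hk
  have hjR : (1:ℝ) ≤ j := by exact_mod_cast hj
  refine ⟨min c 1 / (2*k)^D, C * j^D, by positivity, by positivity, fun n hn => ⟨?_, ?_⟩⟩
  · have hnR : (1:ℝ) ≤ n := by exact_mod_cast hn
    have e : min c 1 / (2*(k:ℝ))^D * (n:ℝ)^D = min c 1 * ((n:ℝ)/(2*k))^D := by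
      rw [div_pow]; ring
    rw [e]
    by_cases hkn : k ≤ n
    · have hq : 1 ≤ n / k := Nat.div_pos hkn hk
      have h3 := (hb (n/k) hq).1
      have h4 : (n:ℝ)/(2*k) ≤ ((n/k : ℕ):ℝ) := by
        rw [div_le_iff₀ (by positivity)]
        have : n ≤ (n/k) * (2*k) := by
          have h5 := Nat.div_add_mod n k
          have h6 := Nat.mod_lt n (show 0 < k by omega)
          nlinarith
        exact_mod_cast this
      calc min c 1 * ((n:ℝ)/(2*k))^D ≤ c * ((n/k : ℕ):ℝ)^D := by
            gcongr; exact min_le_left _ _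
        _ ≤ _ := h3
        _ ≤ ((wBall a (k*(n/k))).card : ℝ) := by exact_mod_cast hlow _
        _ ≤ _ := by
          exact_mod_cast Finset.card_le_card (wBall_mono a (Nat.mul_div_le n k))
    · have h3 : (1:ℝ) ≤ (wBall a n).card := by exact_mod_cast wBall_card_pos a n
      refine le_trans ?_ h3
      have h4 : (n:ℝ)/(2*k) ≤ 1 := by
        rw [div_le_one (by positivity)]
        have : n ≤ 2*k := by omega
        exact_mod_cast this
      calc min c 1 * ((n:ℝ)/(2*k))^D ≤ 1 * 1 := by
            apply mul_le_mul (min_le_right _ _) (pow_le_one₀ (by positivity) h4) (by positivity) (by norm_num)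
        _ = 1 := by norm_num
  · have h3 := (hb (j*n) (Nat.mul_pos hj hn)).2
    calc ((wBall a n).card : ℝ) ≤ (Nat.card ↥(S^(j*n)) : ℝ) := by exact_mod_cast hup n
      _ ≤ _ := h3
      _ = _ := by push_cast; rw [mul_pow]; ring

lemma VolB.doubling {D : ℕ} {c C : ℝ} (h : VolB a D c C) :
    ∃ K : ℝ, 1 ≤ K ∧ ∀ R R' : ℕ, 1 ≤ R → R' ≤ 4*R → ((wBall a R').card : ℝ) ≤ K * (wBall a R).card := by
  obtain ⟨hc, hC, hb⟩ := h
  refine ⟨max 1 (C*4^D/c), le_max_left _ _, fun R R' hR hR' => ?_⟩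
  calc ((wBall a R').card : ℝ) ≤ (wBall a (4*R)).card := by
        exact_mod_cast Finset.card_le_card (wBall_mono a hR')
    _ ≤ C * ((4*R : ℕ):ℝ)^D := (hb _ (by omega)).2
    _ = (C*4^D/c) * (c * (R:ℝ)^D) := by push_cast; rw [mul_pow]; field_simp
    _ ≤ max 1 (C*4^D/c) * (wBall a R).card := by
        apply mul_le_mul (le_max_right _ _) (hb R hR).1 (by positivity) (by positivity)

lemma exists_good_radius {K : ℝ} 
    (hK : ∀ R R' : ℕ, 1 ≤ R → R' ≤ 4*R → ((wBall a R').card : ℝ) ≤ K * (wBall a R).card) :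
    ∃ R0 : ℕ, 1 ≤ R0 ∧ ∀ R, R0 ≤ R → ∃ R', R ≤ R' ∧ R' + 1 ≤ 2*R ∧
      3 * (wBall a (R'+1)).card ≤ 4 * (wBall a R').card := by
  obtain ⟨N, hN⟩ := pow_unbounded_of_one_lt K (show (1:ℝ) < 4/3 by norm_num)
  refine ⟨N+1, by omega, fun R hR => ?_⟩
  by_contra hcon
  push Not at hcon
  have hstep : ∀ j, j ≤ R → (4/3:ℝ)^j * (wBall a R).card ≤ (wBall a (R+j)).card := by
    intro j
    induction j with
    | zero => simp
    | succ j ih =>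
      intro hj
      have h1 := ih (by omega)
      have h2 := hcon (R+j) (by omega) (by omega)
      have h3 : (4:ℝ) * (wBall a (R+j)).card < 3 * (wBall a (R+j+1)).card := by exact_mod_cast h2
      rw [pow_succ, ← add_assoc]
      linarith
  have h1 := hstep R le_rfl
  have h2 := hK R (R+R) (by omega) (by omega)
  have h3 : (4/3:ℝ)^N ≤ (4/3:ℝ)^R := pow_le_pow_right₀ (by norm_num) (by omega)
  have h4 : (0:ℝ) < (wBall a R).card := by exact_mod_cast wBall_card_pos a R
  nlinarith

end Balls
end part2

section part3

section Lower
variable {r : ℕ} {G : Type*} [Group G] [DecidableEq G] (a : Fin r → G)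

/-- Averaging operator killed outside `B`. -/
def killed (B : Finset G) (f : G → ℝ) : G → ℝ := fun y => if y ∈ B then avgL a f y else 0

lemma sum_shift (B : Finset G) (f h : G → ℝ) (hf : ∀ y, y ∉ B → f y = 0) (hh : ∀ y, y ∉ B → h y = 0)
    (g : G) : ∑ y ∈ B, h y * f (g * y) = ∑ y ∈ B, h (g⁻¹ * y) * f y := by
  have h1 : ∑' y, h y * f (g * y) = ∑ y ∈ B, h y * f (g * y) :=
    tsum_eq_sum (fun y hy => by simp [hh y hy])
  have h2 : ∑' y, h (g⁻¹ * y) * f y = ∑ y ∈ B, h (g⁻¹ * y) * f y :=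
    tsum_eq_sum (fun y hy => by simp [hf y hy])
  rw [← h1, ← h2, ← Equiv.tsum_eq (Equiv.mulLeft g) (fun y => h (g⁻¹ * y) * f y)]
  simp

lemma killed_symm (B : Finset G) (f h : G → ℝ) (hf : ∀ y, y ∉ B → f y = 0)
    (hh : ∀ y, y ∉ B → h y = 0) :
    ∑ y ∈ B, h y * killed a B f y = ∑ y ∈ B, killed a B h y * f y := by
  have e1 : ∀ y ∈ B, h y * killed a B f y = 1/2 * (h y * f y) + 1/(4*r) *
      ∑ i, (h y * f (a i * y) + h y * f ((a i)⁻¹ * y)) := by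
    intro y hy
    simp only [killed, if_pos hy, avgL_apply, smul_eq_mul, ← mul_add, ← Finset.mul_sum]
    ring
  have e2 : ∀ y ∈ B, killed a B h y * f y = 1/2 * (h y * f y) + 1/(4*r) *
      ∑ i, (h (a i * y) * f y + h ((a i)⁻¹ * y) * f y) := by
    intro y hy
    simp only [killed, if_pos hy, avgL_apply, smul_eq_mul, ← add_mul, ← Finset.sum_mul]
    ring
  rw [Finset.sum_congr rfl e1, Finset.sum_congr rfl e2]
  rw [Finset.sum_add_distrib, Finset.sum_add_distrib, ← Finset.mul_sum, ← Finset.mul_sum,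
    ← Finset.mul_sum]
  congr 2
  rw [Finset.sum_comm, Finset.sum_comm (s := B)]
  refine Finset.sum_congr rfl fun i _ => ?_
  rw [Finset.sum_add_distrib, Finset.sum_add_distrib, sum_shift B f h hf hh, sum_shift B f h hf hh,
    inv_inv, add_comm]

lemma killed_off (B : Finset G) (f : G → ℝ) (y : G) (hy : y ∉ B) : killed a B f y = 0 := by
  simp [killed, hy]

lemma killed_mono (B : Finset G) {f f' : G → ℝ} (h : f ≤ f') : killed a B f ≤ killed a B f' := by
  intro y
  unfold killed
  split_ifs
  · exact avgL_mono_real a h y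
  · exact le_rfl

lemma killed_iter_mono (B : Finset G) (n : ℕ) {f f' : G → ℝ} (h : f ≤ f') :
    (killed a B)^[n] f ≤ (killed a B)^[n] f' := by
  induction n with
  | zero => simpa using h
  | succ n ih => simp only [Function.iterate_succ_apply']; exact killed_mono a B ih

lemma killed_iter_smul (B : Finset G) (n : ℕ) (c : ℝ) (f : G → ℝ) :
    (killed a B)^[n] (c • f) = c • (killed a B)^[n] f := by
  induction n with
  | zero => simp
  | succ n ih =>
    simp only [Function.iterate_succ_apply', ih]
    funext y
    simp only [killed, map_smul, Pi.smul_apply]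
    split_ifs <;> simp

lemma killed_iter_off (B : Finset G) (n : ℕ) (f : G → ℝ) (hf : ∀ y, y ∉ B → f y = 0) :
    ∀ y, y ∉ B → (killed a B)^[n] f y = 0 := by
  cases n with
  | zero => simpa using hf
  | succ n => intro y hy; rw [Function.iterate_succ_apply']; exact killed_off a B _ y hy

lemma killed_growth (B : Finset G) (f : G → ℝ) (hf : ∀ y, y ∉ B → f y = 0) (ρ : ℝ) (hρ : 0 < ρ)
    (hpos : 0 < ∑ y ∈ B, f y ^ 2)
    (hR : ρ * ∑ y ∈ B, f y ^ 2 ≤ ∑ y ∈ B, f y * killed a B f y) (n : ℕ) :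
    (ρ^n)^2 * ∑ y ∈ B, f y ^ 2 ≤ ∑ y ∈ B, ((killed a B)^[n] f y)^2 := by
  set b : ℕ → ℝ := fun n => ∑ y ∈ B, ((killed a B)^[n] f y)^2 with hb
  have hb0 : b 0 = ∑ y ∈ B, f y ^ 2 := by simp [hb]
  have hstep : ∀ k, b (k+1) ^ 2 ≤ b k * b (k+2) := by
    intro k
    have h1 : b (k+1) = ∑ y ∈ B, (killed a B)^[k] f y * (killed a B)^[k+2] f y := by
      have := killed_symm a B ((killed a B)^[k+1] f) ((killed a B)^[k] f)
        (killed_iter_off a B _ f hf) (killed_iter_off a B _ f hf)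
      rw [← Function.iterate_succ_apply' (killed a B) (k+1) f, ← Function.iterate_succ_apply' (killed a B) k f] at this
      rw [this]
      simp only [hb, sq]
    rw [h1]
    exact Finset.sum_mul_sq_le_sq_mul_sq _ _ _
  have hb1 : ρ^2 * b 0 ≤ b 1 := by
    have h1 := Finset.sum_mul_sq_le_sq_mul_sq B f (killed a B f)
    have h2 : b 1 = ∑ y ∈ B, (killed a B f y)^2 := by simp [hb]
    rw [← h2, ← hb0] at h1
    rw [← hb0] at hR hpos
    have h3 : (ρ * b 0)^2 ≤ (∑ y ∈ B, f y * killed a B f y)^2 := by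
      apply pow_le_pow_left₀ (by positivity) hR
    have h4 : b 0 * (ρ^2 * b 0) ≤ b 0 * b 1 := by nlinarith
    exact le_of_mul_le_mul_left h4 hpos
  have hmain : ∀ k, 0 < b k ∧ ρ^2 * b k ≤ b (k+1) := by
    intro k
    induction k with
    | zero => exact ⟨by rw [hb0]; exact hpos, hb1⟩
    | succ k ih =>
      obtain ⟨h1, h2⟩ := ih
      have h3 : 0 < b (k+1) := lt_of_lt_of_le (by positivity) h2
      refine ⟨h3, ?_⟩
      have h4 := hstep k
      have h5 : b k * (ρ^2 * b (k+1)) ≤ b k * b (k+2) := by nlinarith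
      exact le_of_mul_le_mul_left h5 h1
  rw [← hb0]
  show _ ≤ b n
  clear_value b
  induction n with
  | zero => simp
  | succ n ih =>
    have := (hmain n).2
    calc (ρ^(n+1))^2 * b 0 = ρ^2 * ((ρ^n)^2 * b 0) := by ring
      _ ≤ ρ^2 * b n := by gcongr
      _ ≤ _ := this

lemma killed_survive (B : Finset G) (hB : B.Nonempty) (f : G → ℝ) (hf : ∀ y, y ∉ B → f y = 0)
    (hf1 : ∀ y ∈ B, 1 ≤ f y) (M : ℝ) (hM : 0 < M) (hfM : ∀ y, f y ≤ M) (ρ : ℝ) (hρ : 0 < ρ)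
    (hR : ρ * ∑ y ∈ B, f y ^ 2 ≤ ∑ y ∈ B, f y * killed a B f y) (n : ℕ) :
    ∃ y ∈ B, ρ^n / M ≤ (killed a B)^[n] 1 y := by
  have hpos : 0 < ∑ y ∈ B, f y ^ 2 := by
    apply Finset.sum_pos _ hB
    intro y hy
    have := hf1 y hy
    positivity
  have h0 : (0 : G → ℝ) ≤ f := by
    intro y
    by_cases hy : y ∈ B
    · exact zero_le_one.trans (hf1 y hy)
    · exact (hf y hy).ge
  have h1 := killed_growth a B f hf ρ hρ hpos hR n
  rw [Finset.mul_sum] at h1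
  obtain ⟨y, hy, h2⟩ := Finset.exists_le_of_sum_le hB h1
  refine ⟨y, hy, ?_⟩
  have h3 : 0 ≤ (killed a B)^[n] f y := by
    have := killed_iter_mono a B n h0 y
    have h4 := killed_iter_smul a B n 0 f
    simp only [zero_smul] at h4
    rw [h4] at this
    exact this
  have h5 : ρ^n * f y ≤ (killed a B)^[n] f y := by
    rw [← mul_pow] at h2
    exact le_of_sq_le_sq h2 h3
  have h6 : (killed a B)^[n] f y ≤ M * (killed a B)^[n] 1 y := by
    have := killed_iter_mono a B n (f := f) (f' := M • 1) (fun y => by simpa using hfM y) y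
    rwa [killed_iter_smul] at this
  rw [div_le_iff₀ hM]
  have h7 : ρ^n * 1 ≤ ρ^n * f y := by
    apply mul_le_mul_of_nonneg_left (hf1 y hy) (by positivity)
  linarith

/-- Tent function. -/
def tent (R : ℕ) (y : G) : ℝ := ∑ k ∈ Finset.range (R+1), if y ∈ wBall a k then 1 else 0

lemma tent_off (R : ℕ) (y : G) (hy : y ∉ wBall a R) : tent a R y = 0 := by
  unfold tent
  apply Finset.sum_eq_zero
  intro k hk
  rw [if_neg]
  intro h
  exact hy (wBall_mono a (by simpa [Nat.lt_succ_iff] using hk) h)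

lemma tent_ge (R m : ℕ) (hm : m ≤ R) (y : G) (hy : y ∈ wBall a m) : (R:ℝ) - m + 1 ≤ tent a R y := by
  unfold tent
  have h1 : ∑ k ∈ Finset.Ico m (R+1), (if y ∈ wBall a k then (1:ℝ) else 0) ≤
      ∑ k ∈ Finset.range (R+1), if y ∈ wBall a k then 1 else 0 := by
    apply Finset.sum_le_sum_of_subset_of_nonneg
    · intro k hk; simp at hk ⊢; omega
    · intros; split_ifs <;> norm_num
  refine le_trans (le_of_eq ?_) h1
  rw [Finset.sum_congr rfl (g := fun _ => (1:ℝ))]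
  · simp [Nat.cast_sub (show m ≤ R + 1 by omega)]; ring
  · intro k hk
    rw [if_pos (wBall_mono a (Finset.mem_Ico.1 hk).1 hy)]

lemma tent_le (R : ℕ) (y : G) : tent a R y ≤ R + 1 := by
  unfold tent
  calc _ ≤ ∑ k ∈ Finset.range (R+1), (1:ℝ) := by
        apply Finset.sum_le_sum; intros; split_ifs <;> norm_num
    _ = _ := by simp

lemma tent_lip (R : ℕ) (g : G) (hg : g ∈ gT a) (y : G) : tent a R (g * y) ≤ tent a R y + 1 := by
  unfold tent
  rw [Finset.sum_range_succ _ R, Finset.sum_range_succ' _ R]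
  have h1 : ∑ k ∈ Finset.range R, (if g * y ∈ wBall a k then (1:ℝ) else 0) ≤
      ∑ k ∈ Finset.range R, if y ∈ wBall a (k+1) then (1:ℝ) else 0 := by
    apply Finset.sum_le_sum
    intro k _
    by_cases h : g * y ∈ wBall a k
    · have h2 : y ∈ wBall a (k+1) := by
        have hg' : g⁻¹ ∈ wBall a 1 := inv_mem_ball a (gT_subset_ball_one a hg)
        have := mul_mem_ball a hg' h
        rw [inv_mul_cancel_left, add_comm] at this
        exact this
      rw [if_pos h, if_pos h2]
    · rw [if_neg h]; split_ifs <;> norm_num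
  have h2 : (if g * y ∈ wBall a R then (1:ℝ) else 0) ≤ 1 := by split_ifs <;> norm_num
  have h3 : (0:ℝ) ≤ (if y ∈ wBall a 0 then (1:ℝ) else 0) := by split_ifs <;> norm_num
  linarith

lemma tent_corr (R : ℕ) (g : G) (hg : g ∈ gT a) :
    ∑ y ∈ wBall a R, tent a R y ^ 2 - (wBall a (R+1)).card / 2 ≤
      ∑ y ∈ wBall a R, tent a R y * tent a R (g * y) := by
  have hsub : wBall a R ⊆ wBall a (R+1) := wBall_mono a (by omega)
  have e1 : ∑ y ∈ wBall a R, tent a R y * tent a R (g * y) =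
      ∑ y ∈ wBall a (R+1), tent a R y * tent a R (g * y) :=
    Finset.sum_subset hsub fun y _ hy => by simp [tent_off a R y hy]
  have e2 : ∑ y ∈ wBall a R, tent a R y ^ 2 = ∑ y ∈ wBall a (R+1), tent a R y ^ 2 :=
    Finset.sum_subset hsub fun y _ hy => by simp [tent_off a R y hy]
  have e3 : ∑ y ∈ wBall a R, tent a R y ^ 2 ≤ ∑ y ∈ wBall a (R+1), tent a R (g * y) ^ 2 := by
    have h1 : ∑ y ∈ wBall a R, tent a R y ^ 2 =
        ∑ y ∈ (wBall a R).image (fun y => g⁻¹ * y), tent a R (g * y) ^ 2 := by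
      rw [Finset.sum_image (fun x _ y _ h => by simpa using h)]
      simp
    rw [h1]
    apply Finset.sum_le_sum_of_subset_of_nonneg
    · intro y hy
      obtain ⟨z, hz, rfl⟩ := Finset.mem_image.1 hy
      have := mul_mem_ball a (inv_mem_ball a (gT_subset_ball_one a hg)) hz
      rwa [add_comm] at this
    · intros; positivity
  have hp : ∀ y, tent a R y ^ 2 + tent a R (g * y) ^ 2 - 1 ≤ 2 * (tent a R y * tent a R (g * y)) := by
    intro y
    have h1 := tent_lip a R g hg y
    have h2 := tent_lip a R g⁻¹ (by rw [← gT_inv]; simpa using hg) (g * y)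
    rw [inv_mul_cancel_left] at h2
    nlinarith [mul_nonneg (sub_nonneg.2 h1) (sub_nonneg.2 h2)]
  have hs := Finset.sum_le_sum (fun y (_ : y ∈ wBall a (R+1)) => hp y)
  rw [← Finset.mul_sum, Finset.sum_sub_distrib, Finset.sum_add_distrib, ← e1, ← e2] at hs
  simp only [Finset.sum_const, nsmul_eq_mul, mul_one] at hs
  linarith

lemma tent_rayleigh (hr : r ≠ 0) {K : ℝ} (hK1 : 1 ≤ K)
    (hK : ∀ R R' : ℕ, 1 ≤ R → R' ≤ 4*R → ((wBall a R').card : ℝ) ≤ K * (wBall a R).card)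
    (R : ℕ) (hR : 3 ≤ R) :
    (1 - K/(R:ℝ)^2) * ∑ y ∈ wBall a R, tent a R y ^ 2 ≤
      ∑ y ∈ wBall a R, tent a R y * killed a (wBall a R) (tent a R) y := by
  set Z := ∑ y ∈ wBall a R, tent a R y ^ 2 with hZ
  have hrp : (0:ℝ) < r := by positivity
  have e1 : ∀ y ∈ wBall a R, tent a R y * killed a (wBall a R) (tent a R) y =
      1/2 * tent a R y ^ 2 + 1/(4*r) * ∑ i, (tent a R y * tent a R (a i * y)
        + tent a R y * tent a R ((a i)⁻¹ * y)) := by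
    intro y hy
    simp only [killed, if_pos hy, avgL_apply, smul_eq_mul, ← mul_add, ← Finset.mul_sum]
    ring
  rw [Finset.sum_congr rfl e1, Finset.sum_add_distrib, ← Finset.mul_sum, ← Finset.mul_sum,
    Finset.sum_comm, ← hZ]
  have h1 : ∑ i : Fin r, (2 * (Z - (wBall a (R+1)).card/2)) ≤ ∑ i : Fin r, ∑ y ∈ wBall a R,
      (tent a R y * tent a R (a i * y) + tent a R y * tent a R ((a i)⁻¹ * y)) := by
    apply Finset.sum_le_sum
    intro i _
    rw [Finset.sum_add_distrib]
    have h2 := tent_corr a R _ (gen_mem_gT a i)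
    have h3 := tent_corr a R _ (geninv_mem_gT a i)
    linarith
  have h4 : 1/2 * Z + 1/(4*r) * ∑ i : Fin r, (2 * (Z - (wBall a (R+1)).card/2)) =
      Z - (wBall a (R+1)).card/4 := by
    simp; field_simp; ring
  have h5 : 1/2 * Z + 1/(4*r) * ∑ i : Fin r, (2 * (Z - (wBall a (R+1)).card/2)) ≤ 1/2 * Z +
      1/(4*r) * ∑ i : Fin r, ∑ y ∈ wBall a R,
      (tent a R y * tent a R (a i * y) + tent a R y * tent a R ((a i)⁻¹ * y)) := by gcongr
  refine le_trans ?_ h5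
  rw [h4]
  have h6 : ((wBall a (R/2)).card : ℝ) * ((R:ℝ)/2)^2 ≤ Z := by
    rw [hZ]
    calc ((wBall a (R/2)).card : ℝ) * ((R:ℝ)/2)^2 = ∑ y ∈ wBall a (R/2), ((R:ℝ)/2)^2 := by simp
      _ ≤ ∑ y ∈ wBall a (R/2), tent a R y ^ 2 := by
        apply Finset.sum_le_sum
        intro y hy
        have h7 := tent_ge a R (R/2) (by omega) y hy
        have h8 : ((R/2 : ℕ):ℝ) ≤ (R:ℝ)/2 := Nat.cast_div_le
        apply pow_le_pow_left₀ (by positivity)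
        linarith
      _ ≤ _ := by
        apply Finset.sum_le_sum_of_subset_of_nonneg (wBall_mono a (by omega))
        intros; positivity
  have h7 := hK (R/2) (R+1) (by omega) (by omega)
  have hRp : (0:ℝ) < R := by positivity
  have h8 : (wBall a (R+1)).card / 4 ≤ K/(R:ℝ)^2 * Z := by
    calc ((wBall a (R+1)).card : ℝ) / 4 ≤ K * (wBall a (R/2)).card / 4 := by gcongr
      _ = K/(R:ℝ)^2 * (((wBall a (R/2)).card : ℝ) * ((R:ℝ)/2)^2) := by field_simp; norm_num
      _ ≤ _ := by gcongr
  linarith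

lemma survive_ball (hr : r ≠ 0) {K : ℝ} (hK1 : 1 ≤ K)
    (hK : ∀ R R' : ℕ, 1 ≤ R → R' ≤ 4*R → ((wBall a R').card : ℝ) ≤ K * (wBall a R).card)
    (R : ℕ) (hR : 3 ≤ R) (hKR : K < (R:ℝ)^2) (n : ℕ) :
    ∃ y ∈ wBall a R, (1 - K/(R:ℝ)^2)^n / (R+1) ≤ (killed a (wBall a R))^[n] 1 y := by
  refine killed_survive a (wBall a R) ⟨1, one_mem_ball a R⟩ (tent a R) (tent_off a R) ?_ (R+1)
    (by positivity) (tent_le a R) _ ?_ (tent_rayleigh a hr hK1 hK R hR) n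
  · intro y hy
    have := tent_ge a R R le_rfl y hy
    linarith
  · have : K/(R:ℝ)^2 < 1 := by rw [div_lt_one (by positivity)]; exact hKR
    linarith

section cover
variable {Q : Type*} [Group Q] (s : Fin r → Q) (p : Q →* G)

lemma killed_le_avg (hp : ∀ i, p (s i) = a i) (B : Finset G) (y : G) (A : ℕ → Finset Q)
    (hA : ∀ k γ, γ ∈ A k → p γ * y ∈ B → γ ∈ A (k+1) ∧ ∀ i, s i * γ ∈ A (k+1) ∧ (s i)⁻¹ * γ ∈ A (k+1))
    (n k : ℕ) (γ : Q) (hγ : γ ∈ A k) :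
    (killed a B)^[n] 1 (p γ * y) ≤
      ((avgL s)^n) (fun x => open Classical in if x ∈ A (k+n) then (1:ℝ) else 0) γ := by
  classical
  induction n generalizing k γ with
  | zero => simp [hγ]
  | succ n ih =>
    rw [Function.iterate_succ_apply', pow_succ', Module.End.mul_apply]
    by_cases h : p γ * y ∈ B
    · obtain ⟨h1, h2⟩ := hA k γ hγ h
      rw [killed, if_pos h, avgL_apply, avgL_apply]
      have e : k + (n+1) = (k+1) + n := by ring
      rw [e]
      simp only [smul_eq_mul]
      have i1 := ih (k+1) γ h1
      have i2 : ∀ i, (killed a B)^[n] 1 (a i * (p γ * y)) ≤ ((avgL s)^n) (fun x => open Classical in if x ∈ A (k+1+n) then (1:ℝ) else 0) (s i * γ) := fun i => by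
        have := ih (k+1) _ (h2 i).1
        rwa [map_mul, hp, mul_assoc] at this
      have i3 : ∀ i, (killed a B)^[n] 1 ((a i)⁻¹ * (p γ * y)) ≤ ((avgL s)^n) (fun x => open Classical in if x ∈ A (k+1+n) then (1:ℝ) else 0) ((s i)⁻¹ * γ) := fun i => by
        have := ih (k+1) _ (h2 i).2
        rwa [map_mul, map_inv, hp, mul_assoc] at this
      have h3 : (0:ℝ) ≤ 1/(4*r) := by positivity
      have h4 := Finset.sum_le_sum fun i (_ : i ∈ Finset.univ) => add_le_add (i2 i) (i3 i)
      gcongr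
    · rw [killed_off a B _ _ h]
      have := avgL_pow_mono s (F := 0) (F' := (fun x => open Classical in if x ∈ A (k+(n+1)) then (1:ℝ) else 0))
        (fun x => by simp only [Pi.zero_apply]; split_ifs <;> norm_num) (n+1) γ
      rw [pow_succ', Module.End.mul_apply] at this
      simpa using this

/-- Bounded products in a commutative group. -/
lemma prod_update {M E : Type*} [CommGroup M] [Fintype E] [DecidableEq E] (e : E → M) (φ : E → ℤ) (x : E) (z : ℤ) :
    ∏ j, e j ^ (Function.update φ x (φ x + z) j) = e x ^ z * ∏ j, e j ^ φ j := by
  rw [← Finset.mul_prod_erase _ _ (Finset.mem_univ x), ← Finset.mul_prod_erase _ (fun j => e j ^ φ j) (Finset.mem_univ x)]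
  simp only [Function.update_self]
  rw [Finset.prod_congr rfl (g := fun j => e j ^ φ j), zpow_add, mul_comm (e x ^ φ x), mul_assoc]
  intro j hj
  rw [Function.update_of_ne (Finset.ne_of_mem_erase hj)]

lemma exists_sets (hp : ∀ i, p (s i) = a i) (hsurj : Function.Surjective p)
    (hcomm : ∀ x ∈ p.ker, ∀ y ∈ p.ker, x * y = y * x) (R : ℕ) (y : G) (hy : y ∈ wBall a R) :
    ∃ A : ℕ → Finset Q, (1:Q) ∈ A 0 ∧
    (∀ k γ, γ ∈ A k → p γ * y ∈ wBall a R →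
      γ ∈ A (k+1) ∧ ∀ i, s i * γ ∈ A (k+1) ∧ (s i)⁻¹ * γ ∈ A (k+1)) ∧
    ∀ k, (A k).card ≤ (wBall a (R+1)).card * (2*k+1)^(r * (wBall a (R+1)).card) := by
  classical
  letI : CommGroup p.ker :=
    { (inferInstance : Group p.ker) with
      mul_comm := fun x y => Subtype.ext (hcomm x.1 x.2 y.1 y.2) }
  obtain ⟨σ, hσ⟩ := hsurj.hasRightInverse
  set B := (wBall a (R+1)).image (fun z => z * y⁻¹) with hB
  have hBmem : ∀ g, g * y ∈ wBall a (R+1) → g ∈ B := fun g hg =>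
    Finset.mem_image.2 ⟨g * y, hg, by simp⟩
  have hBcard : B.card = (wBall a (R+1)).card :=
    Finset.card_image_of_injective _ (mul_left_injective _)
  let e : Fin r × B → p.ker := fun x => ⟨(σ (a x.1 * x.2.1))⁻¹ * s x.1 * σ x.2.1, by
    rw [MonoidHom.mem_ker, map_mul, map_mul, map_inv, hσ, hσ, hp]; group⟩
  let m0 : Q := (σ 1)⁻¹
  let Φ : G × (Fin r × B → ℤ) → Q := fun x => σ x.1 * ((∏ j, e j ^ x.2 j : p.ker) : Q) * m0
  let A : ℕ → Finset Q := fun k =>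
    (B ×ˢ Fintype.piFinset (fun _ : Fin r × B => Finset.Icc (-(k:ℤ)) k)).image Φ
  have hΦp : ∀ x, p (Φ x) = x.1 := by
    intro x
    have h1 := (∏ j, e j ^ x.2 j : p.ker).2
    rw [MonoidHom.mem_ker] at h1
    simp only [Φ, m0, map_mul, map_inv, h1, hσ _]
    simp
  refine ⟨A, ?_, ?_, ?_⟩
  · refine Finset.mem_image.2 ⟨(1, 0), ?_, ?_⟩
    · refine Finset.mem_product.2 ⟨hBmem 1 (by simpa using wBall_mono a (by omega) hy), ?_⟩
      rw [Fintype.mem_piFinset]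
      intro j
      simp
    · simp [Φ, m0]
  · intro k γ hγ hpγ
    obtain ⟨⟨g, φ⟩, hx, rfl⟩ := Finset.mem_image.1 hγ
    obtain ⟨hg, hφ⟩ := Finset.mem_product.1 hx
    rw [hΦp] at hpγ
    simp only at hpγ hg hφ
    rw [Fintype.mem_piFinset] at hφ
    have hφ' : ∀ j, -(k:ℤ) ≤ φ j ∧ φ j ≤ k := fun j => Finset.mem_Icc.1 (hφ j)
    have hupd : ∀ (x : Fin r × B) (z : ℤ), (z = 1 ∨ z = -1) →
        Function.update φ x (φ x + z) ∈ Fintype.piFinset (fun _ : Fin r × B => Finset.Icc (-((k+1:ℕ):ℤ)) ((k+1:ℕ):ℤ)) := by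
      intro x z hz
      rw [Fintype.mem_piFinset]
      intro j
      rw [Finset.mem_Icc]
      have h1 := hφ' j
      have h2 := hφ' x
      by_cases hj : j = x
      · subst hj; rw [Function.update_self]; push_cast; omega
      · rw [Function.update_of_ne hj]; push_cast; omega
    refine ⟨?_, fun i => ⟨?_, ?_⟩⟩
    · refine Finset.mem_image.2 ⟨(g, φ), Finset.mem_product.2 ⟨hg, ?_⟩, rfl⟩
      rw [Fintype.mem_piFinset]
      intro j
      rw [Finset.mem_Icc]
      have h1 := hφ' j
      push_cast
      omega
    · refine Finset.mem_image.2 ⟨(a i * g, Function.update φ (i, ⟨g, hg⟩) (φ (i, ⟨g, hg⟩) + 1)),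
        Finset.mem_product.2 ⟨hBmem _ ?_, hupd _ _ (Or.inl rfl)⟩, ?_⟩
      · rw [mul_assoc]; exact gen_mul_mem a i hpγ
      · simp only [Φ, prod_update, zpow_one, Subgroup.coe_mul, e]
        group
    · have hg' : (a i)⁻¹ * g ∈ B := hBmem _ (by rw [mul_assoc]; exact geninv_mul_mem a i hpγ)
      refine Finset.mem_image.2 ⟨((a i)⁻¹ * g, Function.update φ (i, ⟨(a i)⁻¹ * g, hg'⟩) (φ (i, ⟨(a i)⁻¹ * g, hg'⟩) + (-1))),
        Finset.mem_product.2 ⟨hg', hupd _ _ (Or.inr rfl)⟩, ?_⟩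
      simp only [Φ, prod_update, zpow_neg, zpow_one, Subgroup.coe_mul, Subgroup.coe_inv, e, mul_inv_cancel_left]
      group
  · intro k
    refine le_trans Finset.card_image_le ?_
    rw [Finset.card_product, Fintype.card_piFinset, Finset.prod_const, Finset.card_univ, Fintype.card_prod,
      Fintype.card_coe, Fintype.card_fin, Int.card_Icc, hBcard]
    have e1 : ((k:ℤ) + 1 - (-(k:ℤ))).toNat = 2*k+1 := by omega
    rw [e1]

/-- Lower bound for the return probability. -/
theorem lower_main (hr : r ≠ 0) (hp : ∀ i, p (s i) = a i) (hsurj : Function.Surjective p)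
    (hcomm : ∀ x ∈ p.ker, ∀ y ∈ p.ker, x * y = y * x) {K : ℝ} (hK1 : 1 ≤ K)
    (hK : ∀ R R' : ℕ, 1 ≤ R → R' ≤ 4*R → ((wBall a R').card : ℝ) ≤ K * (wBall a R).card)
    (R : ℕ) (hR : 3 ≤ R) (hKR : K < (R:ℝ)^2) (n : ℕ) :
    ((1 - K/(R:ℝ)^2)^n / (R+1))^2 ≤
      ((wBall a (R+1)).card * (2*n+1)^(r * (wBall a (R+1)).card) : ℝ) * ((avgL s)^(2*n)) (dl 1) 1 := by
  obtain ⟨y, hy, h1⟩ := survive_ball a hr hK1 hK R hR hKR n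
  obtain ⟨A, hA0, hA1, hA2⟩ := exists_sets a s p hp hsurj hcomm R y hy
  have h2 := killed_le_avg a s p hp (wBall a R) y A hA1 n 0 1 hA0
  rw [map_one, one_mul, zero_add] at h2
  have h3 := return_ge s n (A n)
  have h4 : 0 ≤ (1 - K/(R:ℝ)^2)^n / (R+1) := by
    have : K/(R:ℝ)^2 < 1 := by rw [div_lt_one (by positivity)]; exact hKR
    have h5 : 0 ≤ 1 - K/(R:ℝ)^2 := by linarith
    positivity
  have h5 := pow_le_pow_left₀ h4 (h1.trans h2) 2
  refine h5.trans (h3.trans ?_)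
  apply mul_le_mul_of_nonneg_right _ (return_pos s _).le
  exact_mod_cast hA2 n
end cover

end Lower
end part3

section part4

section flow
variable {r : ℕ} {G : Type*} [Group G] (a : Fin r → G)

/-- The projection `F_r/[N,N] → G`. -/
def projM : FreeGroup (Fin r) ⧸ ⁅(FreeGroup.lift a).ker, (FreeGroup.lift a).ker⁆ →* G :=
  QuotientGroup.lift _ (FreeGroup.lift a) (by
    intro x hx
    exact Subgroup.commutator_le_left _ _ hx)

lemma projM_mk (x : FreeGroup (Fin r)) : projM a (QuotientGroup.mk x) = FreeGroup.lift a x := rfl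

lemma projM_comm : ∀ x ∈ (projM a).ker, ∀ y ∈ (projM a).ker, x * y = y * x := by
  intro x hx y hy
  induction x using QuotientGroup.induction_on with | _ x
  induction y using QuotientGroup.induction_on with | _ y
  rw [MonoidHom.mem_ker, projM_mk] at hx hy
  rw [← QuotientGroup.mk_mul, ← QuotientGroup.mk_mul, QuotientGroup.eq]
  have := Subgroup.commutator_mem_commutator (H₁ := (FreeGroup.lift a).ker) (H₂ := (FreeGroup.lift a).ker)
    (inv_mem (MonoidHom.mem_ker.2 hy)) (inv_mem (MonoidHom.mem_ker.2 hx))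
  rw [commutatorElement_def] at this
  convert this using 1
  group

/-- elementary step of the flow -/
def flowStep {L : Type*} [AddCommGroup L] (e : Fin r → G → L) (i : Fin r) : Equiv.Perm (G × L) where
  toFun x := (a i * x.1, x.2 + e i x.1)
  invFun x := ((a i)⁻¹ * x.1, x.2 - e i ((a i)⁻¹ * x.1))
  left_inv x := by simp
  right_inv x := by simp

def flowHom {L : Type*} [AddCommGroup L] (e : Fin r → G → L) : FreeGroup (Fin r) →* Equiv.Perm (G × L) :=
  FreeGroup.lift (flowStep a e)

lemma flowHom_spec {L : Type*} [AddCommGroup L] (e : Fin r → G → L) (w : FreeGroup (Fin r)) :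
    ∃ c : G → L, ∀ y t, flowHom a e w (y, t) = (FreeGroup.lift a w * y, t + c y) := by
  induction w using FreeGroup.induction_on with
  | C1 => exact ⟨0, fun y t => by simp⟩
  | of i => exact ⟨e i, fun y t => by simp [flowHom, flowStep]⟩
  | inv_of i _ => exact ⟨fun y => - e i ((a i)⁻¹ * y), fun y t => by
      simp only [flowHom, map_inv, FreeGroup.lift_apply_of]
      rw [← sub_eq_add_neg]; rfl⟩
  | mul x y hx hy =>
    obtain ⟨c, hc⟩ := hx
    obtain ⟨d, hd⟩ := hy
    refine ⟨fun z => d z + c (FreeGroup.lift a y * z), fun z t => ?_⟩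
    rw [map_mul, Equiv.Perm.mul_apply, hd, hc, map_mul, mul_assoc, add_assoc]

lemma flowHom_comm {L : Type*} [AddCommGroup L] (e : Fin r → G → L) :
    ⁅(FreeGroup.lift a).ker, (FreeGroup.lift a).ker⁆ ≤ (flowHom a e).ker := by
  rw [Subgroup.commutator_le]
  intro x hx y hy
  rw [MonoidHom.mem_ker] at *
  obtain ⟨c, hc⟩ := flowHom_spec a e x
  obtain ⟨d, hd⟩ := flowHom_spec a e y
  rw [map_commutatorElement, commutatorElement_eq_one_iff_mul_comm]
  ext1 ⟨z, t⟩
  simp only [Equiv.Perm.mul_apply, hc, hd, hx, hy, one_mul, add_right_comm]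

lemma exists_flow {L : Type*} [AddCommGroup L] (e : Fin r → G → L) :
    ∃ fl : FreeGroup (Fin r) ⧸ ⁅(FreeGroup.lift a).ker, (FreeGroup.lift a).ker⁆ → L, fl 1 = 0 ∧
    (∀ i γ, fl (QuotientGroup.mk (FreeGroup.of i) * γ) = fl γ + e i (projM a γ)) ∧
    (∀ i γ, fl ((QuotientGroup.mk (FreeGroup.of i))⁻¹ * γ) = fl γ - e i ((a i)⁻¹ * projM a γ)) := by
  let Φ : FreeGroup (Fin r) ⧸ ⁅(FreeGroup.lift a).ker, (FreeGroup.lift a).ker⁆ →* Equiv.Perm (G × L) :=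
    QuotientGroup.lift _ (flowHom a e) (fun x hx => flowHom_comm a e hx)
  have hΦ : ∀ w, Φ (QuotientGroup.mk w) = flowHom a e w := fun w => rfl
  have h1 : ∀ γ, (Φ γ (1, 0)).1 = projM a γ := by
    intro γ
    induction γ using QuotientGroup.induction_on with | _ γ
    obtain ⟨c, hc⟩ := flowHom_spec a e γ
    rw [hΦ, hc, projM_mk, mul_one]
  have h2 : ∀ i, Φ (QuotientGroup.mk (FreeGroup.of i)) = flowStep a e i := by
    intro i; rw [hΦ]; simp [flowHom]
  refine ⟨fun γ => (Φ γ (1, 0)).2, by simp, ?_, ?_⟩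
  · intro i γ
    simp only [map_mul, h2, Equiv.Perm.mul_apply]
    rw [← h1]; rfl
  · intro i γ
    simp only [map_mul, map_inv, h2, Equiv.Perm.mul_apply]
    rw [← h1]; rfl

end flow

section phase
variable {r : ℕ} {G : Type*} [Group G] (a : Fin r → G)

/-- Magnetic operator. -/
def phP (u : Fin r → G → ℂ) (f : G → ℂ) : G → ℂ := fun y =>
  (1/2:ℝ) • f y + (1/(4*r):ℝ) • ∑ i, (u i y * f (a i * y) +
    (starRingEnd ℂ) (u i ((a i)⁻¹ * y)) * f ((a i)⁻¹ * y))

variable {Q : Type*} [Group Q] (s : Fin r → Q) (p : Q →* G)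

lemma avgL_phase (hp : ∀ i, p (s i) = a i) (u : Fin r → G → ℂ) (w : Q → ℂ)
    (hw1 : ∀ i γ, w (s i * γ) = w γ * u i (p γ))
    (hw2 : ∀ i γ, w ((s i)⁻¹ * γ) = w γ * (starRingEnd ℂ) (u i ((a i)⁻¹ * p γ)))
    (f : G → ℂ) (k : ℕ) :
    ((avgL s)^k) (fun γ => w γ * f (p γ)) = fun γ => w γ * ((phP a u)^[k] f) (p γ) := by
  induction k with
  | zero => simp
  | succ k ih =>
    rw [pow_succ', Module.End.mul_apply, ih]
    funext γ
    rw [avgL_apply, Function.iterate_succ_apply', phP]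
    simp only [map_mul, map_inv, hp, hw1, hw2, mul_add, Finset.mul_sum, mul_smul_comm, mul_assoc]

lemma avgL_re (F : Q → ℂ) (k : ℕ) (γ : Q) :
    (((avgL s)^k) F γ).re = ((avgL s)^k) (fun γ => (F γ).re) γ := by
  induction k generalizing γ with
  | zero => simp
  | succ k ih =>
    simp only [pow_succ', Module.End.mul_apply, avgL_apply]
    simp [ih, Complex.smul_re]

end phase

section average
variable {r : ℕ} {G : Type*} [Group G] [DecidableEq G] (a : Fin r → G)

/-- The phases attached to `θ`. -/
def phu (m : ℕ) [NeZero m] (Λ : Finset G) (θ : Fin r × Λ → ZMod m) : Fin r → G → ℂ := fun i y =>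
  if h : y ∈ Λ then ZMod.stdAddChar (θ (i, ⟨y, h⟩)) else 1

lemma phu_norm (m : ℕ) [NeZero m] (Λ : Finset G) (θ : Fin r × Λ → ZMod m) (i : Fin r) (y : G) :
    ‖phu m Λ θ i y‖ = 1 := by
  unfold phu
  split_ifs
  · exact AddChar.norm_apply _ _
  · simp

def dlc : G → ℂ := fun y => if y = 1 then 1 else 0

lemma return_le_average (m : ℕ) [NeZero m] (Λ : Finset G) (k : ℕ) :
    (Fintype.card (Fin r × Λ → ZMod m) : ℝ) * ((avgL
      (fun i => (QuotientGroup.mk (FreeGroup.of i) :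
        FreeGroup (Fin r) ⧸ ⁅(FreeGroup.lift a).ker, (FreeGroup.lift a).ker⁆)))^k) (dl 1) 1 ≤
    ∑ θ : Fin r × Λ → ZMod m, (((phP a (phu m Λ θ))^[k] dlc) 1).re := by
  classical
  set s := (fun i => (QuotientGroup.mk (FreeGroup.of i) :
        FreeGroup (Fin r) ⧸ ⁅(FreeGroup.lift a).ker, (FreeGroup.lift a).ker⁆)) with hs
  let e : Fin r → G → ((Fin r × Λ → ZMod m) →+ ZMod m) := fun i y =>
    if h : y ∈ Λ then Pi.evalAddMonoidHom _ (i, ⟨y, h⟩) else 0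
  obtain ⟨fl, f0, f1, f2⟩ := exists_flow a e
  let w : (Fin r × Λ → ZMod m) → (FreeGroup (Fin r) ⧸ ⁅(FreeGroup.lift a).ker, (FreeGroup.lift a).ker⁆) → ℂ :=
    fun θ γ => ZMod.stdAddChar (fl γ θ)
  have he : ∀ θ i y, (ZMod.stdAddChar (e i y θ) : ℂ) = phu m Λ θ i y := by
    intro θ i y
    simp only [e, phu]
    split_ifs <;> simp
  have hp : ∀ i, projM a (s i) = a i := fun i => by simp [hs, projM_mk]
  have key : ∀ θ, ((avgL s)^k) (fun γ => w θ γ * dlc (projM a γ)) 1 = ((phP a (phu m Λ θ))^[k] dlc) 1 := by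
    intro θ
    rw [avgL_phase a s (projM a) hp (phu m Λ θ) (w θ) ?_ ?_ dlc k]
    · simp [w, f0]
    · intro i γ
      simp only [w, hs, f1, AddMonoidHom.add_apply, AddChar.map_add_eq_mul, he]
    · intro i γ
      simp only [w, hs, f2, AddMonoidHom.sub_apply, ← he]
      rw [sub_eq_add_neg, AddChar.map_add_eq_mul, AddChar.map_neg_eq_conj]
  have hsum : ∑ θ : Fin r × Λ → ZMod m, (((phP a (phu m Λ θ))^[k] dlc) 1).re =
      ((avgL s)^k) (fun γ => (∑ θ, w θ γ * dlc (projM a γ)).re) 1 := by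
    rw [← avgL_re]
    have : (fun γ => ∑ θ, w θ γ * dlc (projM a γ)) = ∑ θ, (fun γ => w θ γ * dlc (projM a γ)) := by
      funext γ; simp
    rw [this, map_sum, Finset.sum_apply, Complex.re_sum]
    simp only [key]
  rw [hsum]
  have hmono := avgL_pow_mono s (F := (Fintype.card (Fin r × Λ → ZMod m) : ℝ) • dl 1)
    (F' := fun γ => (∑ θ, w θ γ * dlc (projM a γ)).re) ?_ k 1
  · simpa using hmono
  · intro γ
    show _ ≤ (∑ θ, w θ γ * dlc ((projM a) γ)).re
    rw [← Finset.sum_mul]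
    have hχ : ∑ θ, w θ γ = if (ZMod.stdAddChar (N := m)).compAddMonoidHom (fl γ) = 0
        then (Fintype.card (Fin r × Λ → ZMod m) : ℂ) else 0 := by
      rw [← AddChar.sum_eq_ite]; rfl
    rw [hχ]
    clear hχ hsum
    generalize Fintype.card (Fin r × Λ → ZMod m) = cc
    by_cases h : γ = 1
    · subst h
      have : (ZMod.stdAddChar (N := m)).compAddMonoidHom (fl 1) = 0 := by
        rw [f0]; ext; simp
      rw [if_pos this]
      simp [dl, dlc]
    · have : (0:ℝ) ≤ ((if (ZMod.stdAddChar (N := m)).compAddMonoidHom (fl γ) = 0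
        then (cc : ℂ) else 0) * dlc (projM a γ)).re := by
        unfold dlc
        split_ifs <;> simp
      simpa [dl, h] using this

end average
end part4

section part5

section contraction
variable {r : ℕ} {G : Type*} [Group G] (a : Fin r → G)

/-- Energy density. -/
def eng (u : Fin r → G → ℂ) (f : G → ℂ) (y : G) : ℝ := ∑ i, ‖u i y * f (a i * y) - f y‖^2

lemma eng_nonneg (u : Fin r → G → ℂ) (f : G → ℂ) (y : G) : 0 ≤ eng a u f y :=
  Finset.sum_nonneg fun _ _ => by positivity

lemma norm_add_sq_le (x y : ℂ) : ‖x + y‖^2 ≤ 2 * ‖x‖^2 + 2 * ‖y‖^2 := by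
  have := norm_add_le x y
  nlinarith [norm_nonneg (x+y), sq_nonneg (‖x‖ - ‖y‖), norm_nonneg x, norm_nonneg y]

lemma phP_pointwise (hr : r ≠ 0) (u : Fin r → G → ℂ) (hu : ∀ i y, ‖u i y‖ = 1) (f : G → ℂ) (y : G) :
    ‖phP a u f y‖^2 + (1/(8*r)) * eng a u f y ≤ 1/2 * ‖f y‖^2 +
      (1/(4*r)) * ∑ i, (‖f (a i * y)‖^2 + ‖f ((a i)⁻¹ * y)‖^2) := by
  have hr' : (0:ℝ) < r := by positivity
  set v : Fin r → ℂ := fun i => u i y * f (a i * y) with hv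
  set w : Fin r → ℂ := fun i => (starRingEnd ℂ) (u i ((a i)⁻¹ * y)) * f ((a i)⁻¹ * y) with hw
  have hvn : ∀ i, ‖v i‖ = ‖f (a i * y)‖ := fun i => by simp [hv, hu]
  have hwn : ∀ i, ‖w i‖ = ‖f ((a i)⁻¹ * y)‖ := fun i => by simp [hw, hu]
  have e1 : phP a u f y = (1/(4*r):ℝ) • ∑ i, ((f y + v i) + (f y + w i)) := by
    have : ∑ i, ((f y + v i) + (f y + w i)) = (2*r:ℝ) • f y + ∑ i, (v i + w i) := by
      rw [← sub_eq_iff_eq_add, ← Finset.sum_sub_distrib]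
      simp only [show ∀ i, f y + v i + (f y + w i) - (v i + w i) = (2:ℝ) • f y by
        intro i; rw [two_smul]; ring]
      rw [Finset.sum_const, Finset.card_univ, Fintype.card_fin, ← Nat.cast_smul_eq_nsmul ℝ, smul_smul, mul_comm]
    rw [this, smul_add, smul_smul, phP]
    congr 2
    field_simp
    norm_num
  have e2 : ‖phP a u f y‖^2 ≤ (1/(8*r)) * ∑ i, (‖f y + v i‖^2 + ‖f y + w i‖^2) := by
    rw [e1, norm_smul, mul_pow]
    have h1 : ‖∑ i, ((f y + v i) + (f y + w i))‖^2 ≤ r * ∑ i, ‖(f y + v i) + (f y + w i)‖^2 := by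
      calc _ ≤ (∑ i, ‖(f y + v i) + (f y + w i)‖)^2 :=
            pow_le_pow_left₀ (norm_nonneg _) (norm_sum_le _ _) 2
        _ ≤ _ := by
            have := sq_sum_le_card_mul_sum_sq (s := (Finset.univ : Finset (Fin r))) (f := fun i => ‖(f y + v i) + (f y + w i)‖)
            simpa using this
    have h2 : ∑ i, ‖(f y + v i) + (f y + w i)‖^2 ≤ 2 * ∑ i, (‖f y + v i‖^2 + ‖f y + w i‖^2) := by
      rw [Finset.mul_sum]
      exact Finset.sum_le_sum fun i _ => by
        rw [mul_add]; exact norm_add_sq_le _ _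
    have h3 : ‖(1/(4*r):ℝ)‖^2 = 1/(8*r) * (1/(2*r)) := by
      rw [Real.norm_eq_abs, sq_abs]; field_simp; norm_num
    rw [h3, mul_assoc]
    apply mul_le_mul_of_nonneg_left _ (by positivity)
    rw [one_div, inv_mul_le_iff₀ (by positivity)]
    calc _ ≤ _ := h1
      _ ≤ r * (2 * ∑ i, (‖f y + v i‖^2 + ‖f y + w i‖^2)) := mul_le_mul_of_nonneg_left h2 hr'.le
      _ = _ := by ring
  have e3 : ∀ i, ‖f y + v i‖^2 + ‖f y + w i‖^2 + ‖v i - f y‖^2 ≤ 4 * ‖f y‖^2 + 2 * (‖f (a i * y)‖^2 + ‖f ((a i)⁻¹ * y)‖^2) := by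
    intro i
    have p1 := parallelogram_law_with_norm ℝ (f y) (v i)
    have p2 := norm_add_sq_le (f y) (w i)
    rw [norm_sub_rev] at p1
    rw [hvn] at p1
    rw [hwn] at p2
    nlinarith
  have e4 := Finset.sum_le_sum fun i (_ : i ∈ Finset.univ) => e3 i
  rw [Finset.sum_add_distrib (f := fun i => ‖f y + v i‖^2 + ‖f y + w i‖^2),
    Finset.sum_add_distrib (f := fun _ => 4 * ‖f y‖^2), Finset.sum_const, Finset.card_univ, Fintype.card_fin,
    ← Finset.mul_sum, nsmul_eq_mul] at e4
  have e5 : eng a u f y = ∑ i, ‖v i - f y‖^2 := rfl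
  rw [e5]
  have e6 := mul_le_mul_of_nonneg_left e4 (show (0:ℝ) ≤ 1/(8*r) by positivity)
  have e7 : (1/(8*r):ℝ) * (r * (4 * ‖f y‖^2) + 2 * ∑ i, (‖f (a i * y)‖^2 + ‖f ((a i)⁻¹ * y)‖^2)) =
     1/2 * ‖f y‖^2 + (1/(4*r)) * ∑ i, (‖f (a i * y)‖^2 + ‖f ((a i)⁻¹ * y)‖^2) := by
    field_simp; ring
  rw [e7, mul_add] at e6
  linarith

/-- Squared l2 norm. -/
def nsq (f : G → ℂ) : ℝ := ∑' y, ‖f y‖^2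

lemma nsq_summable {f : G → ℂ} {B : Finset G} (hf : ∀ y, y ∉ B → f y = 0) : Summable fun y => ‖f y‖^2 :=
  summable_of_ne_finset_zero (s := B) fun y hy => by simp [hf y hy]

lemma shift_summable {h : G → ℝ} (hh : Summable h) (g : G) : Summable fun y => h (g * y) :=
  (Equiv.mulLeft g).summable_iff.2 hh

lemma shift_tsum (h : G → ℝ) (g : G) : ∑' y, h (g * y) = ∑' y, h y :=
  (Equiv.mulLeft g).tsum_eq h

lemma eng_summable {f : G → ℂ} {B : Finset G} (hf : ∀ y, y ∉ B → f y = 0) (u : Fin r → G → ℂ)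
    (hu : ∀ i y, ‖u i y‖ = 1) : Summable (eng a u f) := by
  have hs := nsq_summable hf
  refine Summable.of_nonneg_of_le (eng_nonneg a u f) (f := fun y => ∑ i, (2 * ‖f (a i * y)‖^2 + 2*‖f y‖^2)) ?_ ?_
  · intro y
    refine Finset.sum_le_sum fun i _ => ?_
    have := norm_add_sq_le (u i y * f (a i * y)) (- f y)
    rwa [norm_mul, hu, one_mul, norm_neg, ← sub_eq_add_neg] at this
  · exact summable_sum fun i _ => ((shift_summable hs (a i)).mul_left 2).add (hs.mul_left 2)

lemma phP_contract (hr : r ≠ 0) (u : Fin r → G → ℂ) (hu : ∀ i y, ‖u i y‖ = 1) {f : G → ℂ} {B : Finset G}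
    (hf : ∀ y, y ∉ B → f y = 0) :
    nsq (phP a u f) + (1/(8*r)) * ∑' y, eng a u f y ≤ nsq f := by
  have hr' : (0:ℝ) < r := by positivity
  have hs := nsq_summable hf
  have he := eng_summable a hf u hu
  have hsum1 : ∀ i, Summable fun y => (‖f (a i * y)‖^2 + ‖f ((a i)⁻¹ * y)‖^2) := fun i =>
    (shift_summable hs (a i)).add (shift_summable hs (a i)⁻¹)
  have hR : Summable fun y => 1/2 * ‖f y‖^2 +
      (1/(4*r):ℝ) * ∑ i, (‖f (a i * y)‖^2 + ‖f ((a i)⁻¹ * y)‖^2) :=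
    (hs.mul_left _).add ((summable_sum fun i _ => hsum1 i).mul_left _)
  have hP : Summable fun y => ‖phP a u f y‖^2 := by
    refine Summable.of_nonneg_of_le (fun _ => by positivity) (fun y => ?_) hR
    have := phP_pointwise a hr u hu f y
    have h2 := eng_nonneg a u f y
    have h3 : 0 ≤ (1/(8*r):ℝ) * eng a u f y := by positivity
    linarith
  have h1 := Summable.tsum_le_tsum (phP_pointwise a hr u hu f) (hP.add (he.mul_left _)) hR
  rw [hP.tsum_add (he.mul_left _), tsum_mul_left, (hs.mul_left _).tsum_add ((summable_sum fun i _ => hsum1 i).mul_left _),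
    tsum_mul_left, tsum_mul_left, Summable.tsum_finsetSum (fun i _ => hsum1 i)] at h1
  have h2 : ∀ i, ∑' y, (‖f (a i * y)‖^2 + ‖f ((a i)⁻¹ * y)‖^2) = 2 * nsq f := by
    intro i
    rw [(shift_summable hs (a i)).tsum_add (shift_summable hs (a i)⁻¹), shift_tsum (fun y => ‖f y‖^2),
      shift_tsum (fun y => ‖f y‖^2), nsq]; ring
  simp only [h2, Finset.sum_const, Finset.card_univ, Fintype.card_fin, nsmul_eq_mul] at h1
  refine h1.trans (le_of_eq ?_)
  rw [← nsq]
  field_simp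
  ring

variable [DecidableEq G]

lemma phP_support (u : Fin r → G → ℂ) {f : G → ℂ} {k : ℕ} (hf : ∀ y, y ∉ wBall a k → f y = 0) :
    ∀ y, y ∉ wBall a (k+1) → phP a u f y = 0 := by
  intro y hy
  have h0 : f y = 0 := hf y fun h => hy (wBall_mono a (by omega) h)
  have h1 : ∀ i, f (a i * y) = 0 := fun i => hf _ fun h => hy (by
    simpa using geninv_mul_mem a i h)
  have h2 : ∀ i, f ((a i)⁻¹ * y) = 0 := fun i => hf _ fun h => hy (by
    simpa using gen_mul_mem a i h)
  simp [phP, h0, h1, h2]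

lemma phP_iter_support (u : Fin r → G → ℂ) (k : ℕ) :
    ∀ y, y ∉ wBall a k → ((phP a u)^[k] dlc) y = 0 := by
  induction k with
  | zero => intro y hy; rw [wBall_zero, Finset.mem_singleton] at hy; simp [dlc, hy]
  | succ k ih => rw [Function.iterate_succ_apply']; exact phP_support a u ih

/-- Local coercivity at `x`. -/
def GoodAt (u : Fin r → G → ℂ) (R : ℕ) (κ : ℝ) (x : G) : Prop :=
  ∀ f : G → ℂ, κ * ∑ y ∈ wBall a R, ‖f (y * x)‖^2 ≤ ∑ y ∈ wBall a (3*R+1), eng a u f (y * x)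

lemma good_energy (u : Fin r → G → ℂ) (hu : ∀ i y, ‖u i y‖ = 1) {R N : ℕ} {κ K : ℝ} (hκ : 0 ≤ κ)
    (hK0 : 0 < K) (hK : ((wBall a (3*R+1)).card : ℝ) ≤ K * (wBall a R).card)
    (hgood : ∀ x ∈ wBall a (N+R), GoodAt a u R κ x)
    {f : G → ℂ} (hf : ∀ y, y ∉ wBall a N → f y = 0) :
    κ / K * nsq f ≤ ∑' y, eng a u f y := by
  have hs := nsq_summable hf
  have he := eng_summable a hf u hu
  have h1 := Finset.sum_le_sum fun x hx => hgood x hx f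
  rw [← Finset.mul_sum, Finset.sum_comm, Finset.sum_comm (t := wBall a (3*R+1))] at h1
  have h2 : ∀ y ∈ wBall a R, ∑ x ∈ wBall a (N+R), ‖f (y * x)‖^2 = nsq f := by
    intro y hy
    rw [nsq, ← shift_tsum _ y]
    refine (tsum_eq_sum fun x hx => ?_).symm
    rw [hf, norm_zero]; · ring
    intro h
    apply hx
    have := mul_mem_ball a (inv_mem_ball a hy) h
    rw [inv_mul_cancel_left, add_comm] at this
    exact this
  have h3 : ∀ y ∈ wBall a (3*R+1), ∑ x ∈ wBall a (N+R), eng a u f (y * x) ≤ ∑' y, eng a u f y := by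
    intro y hy
    rw [← shift_tsum _ y]
    exact (shift_summable he y).sum_le_tsum _ fun i _ => eng_nonneg a u f _
  rw [Finset.sum_congr rfl h2, Finset.sum_const, nsmul_eq_mul] at h1
  have h4 := h1.trans (Finset.sum_le_sum h3)
  rw [Finset.sum_const, nsmul_eq_mul] at h4
  have hE : 0 ≤ ∑' y, eng a u f y := tsum_nonneg (eng_nonneg a u f)
  have hpos : (0:ℝ) < (wBall a R).card := by exact_mod_cast wBall_card_pos a R
  have h5 : (wBall a R).card * (κ * nsq f) ≤ (wBall a R).card * (K * ∑' y, eng a u f y) := by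
    calc _ = κ * ((wBall a R).card * nsq f) := by ring
      _ ≤ _ := h4
      _ ≤ (K * (wBall a R).card) * ∑' y, eng a u f y := by gcongr
      _ = _ := by ring
  have h6 := le_of_mul_le_mul_left h5 hpos
  rw [div_mul_eq_mul_div, div_le_iff₀ hK0]
  linarith

lemma nsq_dlc : nsq (dlc : G → ℂ) = 1 := by
  rw [nsq, tsum_eq_single 1]
  · simp [dlc]
  · intro y hy; simp [dlc, hy]

lemma iter_nsq_le_one (hr : r ≠ 0) (u : Fin r → G → ℂ) (hu : ∀ i y, ‖u i y‖ = 1) (k : ℕ) :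
    nsq ((phP a u)^[k] dlc) ≤ 1 := by
  induction k with
  | zero => simp [nsq_dlc]
  | succ k ih =>
    rw [Function.iterate_succ_apply']
    have h1 := phP_contract a hr u hu (phP_iter_support a u k)
    have hE : 0 ≤ ∑' y, eng a u ((phP a u)^[k] dlc) y := tsum_nonneg (eng_nonneg a u _)
    have : 0 ≤ (1/(8*r):ℝ) * ∑' y, eng a u ((phP a u)^[k] dlc) y := by positivity
    linarith

lemma iter_nsq_good (hr : r ≠ 0) (u : Fin r → G → ℂ) (hu : ∀ i y, ‖u i y‖ = 1) {R N : ℕ} {κ K : ℝ} (hκ : 0 ≤ κ)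
    (hK0 : 0 < K) (hK : ((wBall a (3*R+1)).card : ℝ) ≤ K * (wBall a R).card)
    (hgood : ∀ x ∈ wBall a (N+R), GoodAt a u R κ x) (hsmall : κ / (8*r*K) ≤ 1) (k : ℕ) (hk : k ≤ N) :
    nsq ((phP a u)^[k] dlc) ≤ (1 - κ/(8*r*K))^k := by
  have hr' : (0:ℝ) < r := by positivity
  induction k with
  | zero => simp [nsq_dlc]
  | succ k ih =>
    have ih := ih (by omega)
    rw [Function.iterate_succ_apply']
    have h1 := phP_contract a hr u hu (phP_iter_support a u k)
    have h2 := good_energy a u hu hκ hK0 hK hgood (f := (phP a u)^[k] dlc)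
      (fun y hy => phP_iter_support a u k y fun h => hy (wBall_mono a (by omega) h))
    have h3 := mul_le_mul_of_nonneg_left h2 (show (0:ℝ) ≤ 1/(8*r) by positivity)
    have h4 : (1/(8*r):ℝ) * (κ/K * nsq ((phP a u)^[k] dlc)) = κ/(8*r*K) * nsq ((phP a u)^[k] dlc) := by
      field_simp
    rw [h4] at h3
    calc _ ≤ (1 - κ/(8*r*K)) * nsq ((phP a u)^[k] dlc) := by linarith
      _ ≤ (1 - κ/(8*r*K)) * (1 - κ/(8*r*K))^k := by gcongr
      _ = _ := by ring

lemma norm_le_of_nsq (u : Fin r → G → ℂ) (k : ℕ) :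
    ‖((phP a u)^[k] dlc) 1‖^2 ≤ nsq ((phP a u)^[k] dlc) :=
  (nsq_summable (phP_iter_support a u k)).le_tsum (1:G) fun _ _ => by positivity

/-- Upper bound in terms of the number of bad phase configurations. -/
lemma upper_of_bad (hr : r ≠ 0) (m : ℕ) [NeZero m] (Λ : Finset G) {R n : ℕ} {κ K δ : ℝ} (hκ : 0 ≤ κ)
    (hK0 : 0 < K) (hK : ((wBall a (3*R+1)).card : ℝ) ≤ K * (wBall a R).card) (hsmall : κ / (8*r*K) ≤ 1)
    (hbad : ∀ x ∈ wBall a (2*n+R), (Nat.card {θ : Fin r × Λ → ZMod m // ¬ GoodAt a (phu m Λ θ) R κ x} : ℝ) ≤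
      δ * Fintype.card (Fin r × Λ → ZMod m)) :
    ((avgL (fun i => (QuotientGroup.mk (FreeGroup.of i) :
        FreeGroup (Fin r) ⧸ ⁅(FreeGroup.lift a).ker, (FreeGroup.lift a).ker⁆)))^(2*n)) (dl 1) 1 ≤
    (1 - κ/(8*r*K))^n + (wBall a (2*n+R)).card * δ := by
  classical
  have h0 := return_le_average a m Λ (2*n)
  set c : ℝ := (Fintype.card (Fin r × Λ → ZMod m) : ℝ) with hc
  have hcpos : 0 < c := by rw [hc]; exact_mod_cast Fintype.card_pos
  set ρ := 1 - κ/(8*r*K) with hρ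
  have hρ0 : 0 ≤ ρ := by linarith
  set X := wBall a (2*n+R) with hX
  have h1 : ∀ θ : Fin r × Λ → ZMod m, (((phP a (phu m Λ θ))^[2*n] dlc) 1).re ≤
      ρ^n + ∑ x ∈ X, if ¬ GoodAt a (phu m Λ θ) R κ x then (1:ℝ) else 0 := by
    intro θ
    have hS : 0 ≤ ∑ x ∈ X, if ¬ GoodAt a (phu m Λ θ) R κ x then (1:ℝ) else 0 :=
      Finset.sum_nonneg fun x _ => by split_ifs <;> norm_num
    have hre := Complex.re_le_norm (((phP a (phu m Λ θ))^[2*n] dlc) 1)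
    have hsq := norm_le_of_nsq a (phu m Λ θ) (2*n)
    by_cases hg : ∀ x ∈ X, GoodAt a (phu m Λ θ) R κ x
    · have h2 := iter_nsq_good a hr (phu m Λ θ) (phu_norm m Λ θ) hκ hK0 hK hg hsmall (2*n) le_rfl
      have h3 : ‖((phP a (phu m Λ θ))^[2*n] dlc) 1‖ ≤ ρ^n := by
        apply le_of_sq_le_sq _ (by positivity)
        rw [← pow_mul, mul_comm n 2]
        exact hsq.trans h2
      linarith
    · push Not at hg
      obtain ⟨x, hx, hgx⟩ := hg
      have h2 := iter_nsq_le_one a hr (phu m Λ θ) (phu_norm m Λ θ) (2*n)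
      have h3 : ‖((phP a (phu m Λ θ))^[2*n] dlc) 1‖ ≤ 1 := by
        apply le_of_sq_le_sq _ (by positivity)
        linarith
      have h4 : (1:ℝ) ≤ ∑ x ∈ X, if ¬ GoodAt a (phu m Λ θ) R κ x then (1:ℝ) else 0 := by
        have := Finset.single_le_sum (f := fun x => if ¬ GoodAt a (phu m Λ θ) R κ x then (1:ℝ) else 0)
          (fun x _ => by split_ifs <;> norm_num) hx
        simpa only [hgx, not_false_eq_true, if_true] using this
      have : 0 ≤ ρ^n := by positivity
      linarith
  have h2 := h0.trans (Finset.sum_le_sum fun θ _ => h1 θ)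
  rw [Finset.sum_add_distrib, Finset.sum_comm, Finset.sum_const, Finset.card_univ, nsmul_eq_mul, ← hc] at h2
  have h3 : ∀ x ∈ X, ∑ θ : Fin r × Λ → ZMod m, (if ¬ GoodAt a (phu m Λ θ) R κ x then (1:ℝ) else 0) ≤ δ * c := by
    intro x hx
    refine le_trans (le_of_eq ?_) (hbad x hx)
    rw [Finset.sum_boole, Nat.card_eq_fintype_card, Fintype.card_subtype]
  have h4 := Finset.sum_le_sum h3
  rw [Finset.sum_const, nsmul_eq_mul] at h4
  refine le_of_mul_le_mul_left (a := c) ?_ hcpos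
  calc _ ≤ _ := h2
    _ ≤ c * ρ^n + X.card * (δ * c) := by linarith
    _ = _ := by ring

end contraction
end part5

section part6

section poincare
variable {r : ℕ} {G : Type*} [Group G] [DecidableEq G] (a : Fin r → G)

lemma sum_mul_left_le (h : G → ℝ) (hh : ∀ y, 0 ≤ h y) (A B : Finset G) (g : G)
    (hAB : ∀ y ∈ A, g * y ∈ B) : ∑ y ∈ A, h (g * y) ≤ ∑ y ∈ B, h y := by
  rw [← Finset.sum_image (f := h) (g := fun y => g * y) (s := A) (fun x _ y _ h => mul_left_cancel h)]
  exact Finset.sum_le_sum_of_subset_of_nonneg (fun z hz => by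
    obtain ⟨y, hy, rfl⟩ := Finset.mem_image.1 hz; exact hAB y hy) (fun z _ _ => hh z)

lemma poincare_step (g : G → ℝ) (R : ℕ) {M : ℝ}
    (hM : ∑ y ∈ wBall a (R+1), ∑ i, (g (a i * y) - g y)^2 ≤ M) (t : G) (ht : t ∈ gT a) :
    ∑ y ∈ wBall a R, (g (t * y) - g y)^2 ≤ M := by
  have hnn : ∀ y, 0 ≤ ∑ i, (g (a i * y) - g y)^2 := fun y => Finset.sum_nonneg fun _ _ => sq_nonneg _
  have hM0 : 0 ≤ M := le_trans (Finset.sum_nonneg fun y _ => hnn y) hM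
  rcases (mem_gT a).1 ht with rfl | ⟨i, rfl⟩ | ⟨i, rfl⟩
  · simpa using hM0
  · refine le_trans ?_ hM
    refine le_trans (Finset.sum_le_sum_of_subset_of_nonneg (wBall_mono a (Nat.le_succ R)) fun _ _ _ => sq_nonneg _) ?_
    exact Finset.sum_le_sum fun y _ => Finset.single_le_sum (f := fun i => (g (a i * y) - g y)^2)
      (fun _ _ => sq_nonneg _) (Finset.mem_univ i)
  · refine le_trans ?_ hM
    have h1 := sum_mul_left_le (fun y => ∑ i, (g (a i * y) - g y)^2) hnn (wBall a R) (wBall a (R+1)) (a i)⁻¹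
      (fun y hy => geninv_mul_mem a i hy)
    refine le_trans ?_ h1
    refine Finset.sum_le_sum fun y _ => ?_
    have h2 := Finset.single_le_sum (f := fun j => (g (a j * ((a i)⁻¹ * y)) - g ((a i)⁻¹ * y))^2)
      (fun _ _ => sq_nonneg _) (Finset.mem_univ i)
    refine le_trans (le_of_eq ?_) h2
    simp only [mul_inv_cancel_left]
    ring

lemma poincare_iter (g : G → ℝ) (R : ℕ) {M : ℝ}
    (hM : ∑ y ∈ wBall a (3*R+1), ∑ i, (g (a i * y) - g y)^2 ≤ M) (k : ℕ) (hk : k ≤ 2*R) (h : G) (hh : h ∈ wBall a k) :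
    ∑ y ∈ wBall a R, (g (h * y) - g y)^2 ≤ (k:ℝ)^2 * M := by
  induction k generalizing h with
  | zero => rw [wBall_zero, Finset.mem_singleton] at hh; simp [hh]
  | succ k ih =>
    rw [add_comm k 1, wBall_add] at hh
    obtain ⟨t, ht, h', hh', rfl⟩ := Finset.mem_mul.1 hh
    have ht' : t ∈ gT a := by simpa [wBall] using ht
    have i1 := ih (by omega) h' hh'
    have i2 : ∑ y ∈ wBall a R, (g (t * (h' * y)) - g (h' * y))^2 ≤ M := by
      refine le_trans ?_ (poincare_step a g (3*R) hM t ht')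
      exact sum_mul_left_le (fun y => (g (t * y) - g y)^2) (fun _ => sq_nonneg _) (wBall a R) (wBall a (3*R)) h'
        fun y hy => wBall_mono a (by omega) (mul_mem_ball a hh' hy)
    rcases Nat.eq_zero_or_pos k with rfl | hk0
    · rw [wBall_zero, Finset.mem_singleton] at hh'
      subst hh'
      simpa using i2
    · have hk' : (0:ℝ) < k := by exact_mod_cast hk0
      have i3 : ∀ y ∈ wBall a R, (g (t * h' * y) - g y)^2 ≤
          (1 + k) * (g (t * (h' * y)) - g (h' * y))^2 + (1 + 1/k) * (g (h' * y) - g y)^2 := by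
        intro y _
        rw [mul_assoc]
        set A := g (t * (h' * y)) - g (h' * y)
        set B := g (h' * y) - g y
        have e : g (t * (h' * y)) - g y = A + B := by simp [A, B]
        rw [e]
        have : (1 + (k:ℝ)) * A^2 + (1 + 1/k) * B^2 - (A+B)^2 = (k * A - B)^2 / k := by
          field_simp; ring
        have h2 : 0 ≤ (k * A - B)^2 / k := by positivity
        linarith
      refine (Finset.sum_le_sum i3).trans ?_
      rw [Finset.sum_add_distrib, ← Finset.mul_sum, ← Finset.mul_sum]
      calc _ ≤ (1 + (k:ℝ)) * M + (1 + 1/k) * ((k:ℝ)^2 * M) := by gcongr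
        _ = _ := by push_cast; field_simp; ring

lemma poincare (g : G → ℝ) (R : ℕ) {M : ℝ}
    (hM : ∑ y ∈ wBall a (3*R+1), ∑ i, (g (a i * y) - g y)^2 ≤ M) :
    ∑ y ∈ wBall a R, ∑ z ∈ wBall a R, (g z - g y)^2 ≤ (wBall a (2*R)).card * (4 * (R:ℝ)^2 * M) := by
  calc ∑ y ∈ wBall a R, ∑ z ∈ wBall a R, (g z - g y)^2
      ≤ ∑ y ∈ wBall a R, ∑ h ∈ wBall a (2*R), (g (h * y) - g y)^2 := by
        refine Finset.sum_le_sum fun y hy => ?_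
        rw [← Finset.sum_image (f := fun z => (g z - g y)^2) (g := fun h => h * y) (s := wBall a (2*R))
          (fun x _ z _ h => mul_right_cancel h)]
        refine Finset.sum_le_sum_of_subset_of_nonneg (fun z hz => ?_) fun _ _ _ => sq_nonneg _
        refine Finset.mem_image.2 ⟨z * y⁻¹, ?_, by simp⟩
        have := mul_mem_ball a hz (inv_mem_ball a hy)
        rwa [← two_mul] at this
    _ = ∑ h ∈ wBall a (2*R), ∑ y ∈ wBall a R, (g (h * y) - g y)^2 := Finset.sum_comm
    _ ≤ ∑ h ∈ wBall a (2*R), (((2*R:ℕ):ℝ)^2 * M) :=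
        Finset.sum_le_sum fun h hh => poincare_iter a g R hM _ le_rfl h hh
    _ = _ := by rw [Finset.sum_const, nsmul_eq_mul]; push_cast; ring

lemma small_level_set (g : G → ℝ) (hg : ∀ y, 0 ≤ g y) (B Z : Finset G) (hZ : Z ⊆ B) {α : ℝ} (hα : 0 ≤ α)
    (hS : ∑ y ∈ B, g y ^2 = α^2 * B.card) (hZα : ∀ y ∈ Z, g y < α/2) :
    Z.card * (α^2 * B.card / 4) ≤ ∑ y ∈ B, ∑ z ∈ B, (g z - g y)^2 := by
  have h1 : ∀ y ∈ Z, α^2 * B.card / 4 ≤ ∑ z ∈ B, (g z - g y)^2 := by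
    intro y hy
    have h2 : ∀ z ∈ B, g z^2/2 - α^2/4 ≤ (g z - g y)^2 := by
      intro z _
      have h3 : g y^2 ≤ α^2/4 := by nlinarith [hZα y hy, hg y]
      nlinarith [sq_nonneg (g z - 2 * g y)]
    have h3 := Finset.sum_le_sum h2
    rw [Finset.sum_sub_distrib, ← Finset.sum_div, hS, Finset.sum_const, nsmul_eq_mul] at h3
    linarith
  have h2 := Finset.sum_le_sum h1
  rw [Finset.sum_const, nsmul_eq_mul] at h2
  exact h2.trans (Finset.sum_le_sum_of_subset_of_nonneg hZ fun y _ _ => Finset.sum_nonneg fun _ _ => sq_nonneg _)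

/-- Structure of bad phase configurations. -/
lemma bad_struct (I : Finset (Fin r)) (hI : I.card = 2) (R0 : ℕ) {K : ℝ} (hK1 : 1 ≤ K)
    (hK : ((wBall a (2*(R0+1))).card : ℝ) ≤ K * (wBall a (R0+1)).card)
    (u : Fin r → G → ℂ) (hu : ∀ i y, ‖u i y‖ = 1) (f : G → ℂ)
    (hbad : ∑ y ∈ wBall a (3*(R0+1)+1), eng a u f y <
      (1/(1024*K))/((R0+1:ℕ):ℝ)^2 * ∑ y ∈ wBall a (R0+1), ‖f y‖^2) :
    ∃ J ⊆ I ×ˢ wBall a R0, 4 * J.card ≤ (wBall a (R0+1)).card ∧ ∃ w : G → ℂ, (∀ y, ‖w y‖ = 1) ∧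
      ∀ e ∈ (I ×ˢ wBall a R0) \ J, ‖u e.1 e.2 * w (a e.1 * e.2) - w e.2‖ ≤ 4/((R0+1:ℕ):ℝ) := by
  set R := R0+1 with hR
  have hRpos : (0:ℝ) < (R:ℝ) := by positivity
  set B := wBall a R with hB
  set ε := 1/(1024*K) with hε
  have hε0 : 0 < ε := by positivity
  have hεK : ε * K = 1/1024 := by rw [hε]; field_simp
  set g : G → ℝ := fun y => ‖f y‖ with hg
  set S := ∑ y ∈ B, ‖f y‖^2 with hS
  have hb : (0:ℝ) < B.card := by exact_mod_cast wBall_card_pos a R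
  have hengnn : 0 ≤ ∑ y ∈ wBall a (3*R+1), eng a u f y := Finset.sum_nonneg fun y _ => eng_nonneg a u f y
  have hSpos : 0 < S := by
    have : 0 < ε / (R:ℝ)^2 * S := lt_of_le_of_lt hengnn hbad
    exact pos_of_mul_pos_right this (by positivity)
  set α := Real.sqrt (S / B.card) with hα
  have hα0 : 0 < α := Real.sqrt_pos.2 (by positivity)
  have hα2 : α^2 = S / B.card := Real.sq_sqrt (by positivity)
  have hSα : S = α^2 * B.card := by rw [hα2]; field_simp
  have hM : ∑ y ∈ wBall a (3*R+1), ∑ i, (g (a i * y) - g y)^2 ≤ ε / (R:ℝ)^2 * S := by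
    refine le_trans (Finset.sum_le_sum fun y _ => Finset.sum_le_sum fun i _ => ?_) hbad.le
    have h1 := abs_norm_sub_norm_le (u i y * f (a i * y)) (f y)
    rw [norm_mul, hu, one_mul] at h1
    rw [← sq_abs]
    exact pow_le_pow_left₀ (abs_nonneg _) h1 2
  set Z := B.filter (fun y => g y < α/2) with hZ
  have hZcard : 128 * (Z.card:ℝ) ≤ 4 * B.card := by
    have h1 := small_level_set g (fun _ => norm_nonneg _) B Z (Finset.filter_subset _ _) hα0.le hSα
      (fun y hy => (Finset.mem_filter.1 hy).2)
    have h2 := poincare a g R hM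
    have h3 : ((wBall a (2*R)).card : ℝ) * (4 * (R:ℝ)^2 * (ε / (R:ℝ)^2 * S)) ≤ (K * B.card) * (4 * ε * S) := by
      have : (4 * (R:ℝ)^2 * (ε / (R:ℝ)^2 * S)) = 4 * ε * S := by field_simp
      rw [this]
      gcongr
    have h4 := (h1.trans h2).trans h3
    have h5 : (K * B.card) * (4 * ε * S) = S * (B.card / 256) := by
      calc _ = (ε * K) * 4 * S * B.card := by ring
        _ = _ := by rw [hεK]; ring
    rw [h5, ← hSα] at h4
    have h6 : S * (Z.card/4:ℝ) ≤ S * (B.card / 256) := by linarith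
    have h7 := le_of_mul_le_mul_left h6 hSpos
    have h8 : 0 ≤ (Z.card:ℝ) := Nat.cast_nonneg _
    linarith
  set E := I ×ˢ wBall a R0 with hE
  set J1 := E.filter (fun e => e.2 ∈ Z) with hJ1
  set J2 := E.filter (fun e => a e.1 * e.2 ∈ Z) with hJ2
  set J3 := E.filter (fun e => α/R < ‖u e.1 e.2 * f (a e.1 * e.2) - f e.2‖) with hJ3
  have c1 : J1.card ≤ 2 * Z.card := by
    rw [← hI, ← Finset.card_product]
    apply Finset.card_le_card
    intro e he
    rw [hJ1, Finset.mem_filter, hE, Finset.mem_product] at he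
    exact Finset.mem_product.2 ⟨he.1.1, he.2⟩
  have c2 : J2.card ≤ 2 * Z.card := by
    rw [← hI, ← Finset.card_product]
    apply Finset.card_le_card_of_injOn (fun e => (e.1, a e.1 * e.2))
    · intro e he
      rw [Finset.mem_coe, hJ2, Finset.mem_filter, hE, Finset.mem_product] at he
      exact Finset.mem_product.2 ⟨he.1.1, he.2⟩
    · rintro ⟨i, y⟩ _ ⟨j, z⟩ _ h
      simp only [Prod.mk.injEq] at h
      obtain ⟨rfl, h⟩ := h
      rw [mul_left_cancel h]
  have c3 : (J3.card:ℝ) ≤ ε * B.card := by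
    have h1 : ∀ e ∈ J3, (α/R)^2 ≤ ‖u e.1 e.2 * f (a e.1 * e.2) - f e.2‖^2 := by
      intro e he
      exact pow_le_pow_left₀ (div_pos hα0 hRpos).le (Finset.mem_filter.1 he).2.le 2
    have h2 := Finset.sum_le_sum h1
    rw [Finset.sum_const, nsmul_eq_mul] at h2
    have h3 : ∑ e ∈ J3, ‖u e.1 e.2 * f (a e.1 * e.2) - f e.2‖^2 ≤ ∑ y ∈ wBall a (3*R+1), eng a u f y := by
      refine le_trans (Finset.sum_le_sum_of_subset_of_nonneg
        (t := (Finset.univ : Finset (Fin r)) ×ˢ wBall a (3*R+1)) ?_ fun _ _ _ => by positivity) ?_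
      · intro e he
        rw [hJ3, Finset.mem_filter, hE, Finset.mem_product] at he
        exact Finset.mem_product.2 ⟨Finset.mem_univ _, wBall_mono a (by omega) he.1.2⟩
      · rw [Finset.sum_product_right]
        rfl
    have h4 : (J3.card:ℝ) * (α/R)^2 ≤ (α/R)^2 * (ε * B.card) := by
      calc _ ≤ _ := h2.trans (h3.trans hbad.le)
        _ = _ := by rw [hSα]; ring
    rw [mul_comm] at h4
    exact le_of_mul_le_mul_left h4 (pow_pos (div_pos hα0 hRpos) 2)
  refine ⟨J1 ∪ J2 ∪ J3, ?_, ?_, fun y => if f y = 0 then 1 else f y / (g y : ℂ), ?_, ?_⟩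
  · exact Finset.union_subset (Finset.union_subset (Finset.filter_subset _ _) (Finset.filter_subset _ _)) (Finset.filter_subset _ _)
  · have h1 : (J1 ∪ J2 ∪ J3).card ≤ J1.card + J2.card + J3.card :=
      (Finset.card_union_le _ _).trans (by have := Finset.card_union_le J1 J2; omega)
    have h2 : ((J1 ∪ J2 ∪ J3).card : ℝ) ≤ 4 * Z.card + ε * B.card := by
      have : ((J1 ∪ J2 ∪ J3).card : ℝ) ≤ J1.card + J2.card + J3.card := by exact_mod_cast h1
      have c1' : (J1.card:ℝ) ≤ 2 * Z.card := by exact_mod_cast c1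
      have c2' : (J2.card:ℝ) ≤ 2 * Z.card := by exact_mod_cast c2
      linarith
    have hε1 : ε ≤ 1/1024 := by
      rw [← hεK]; nlinarith
    have h3 : ε * B.card ≤ 1/1024 * B.card := mul_le_mul_of_nonneg_right hε1 hb.le
    have : (4:ℝ) * (J1 ∪ J2 ∪ J3).card ≤ B.card := by linarith
    exact_mod_cast this
  · intro y
    simp only
    split_ifs with h
    · simp
    · simp [hg, h]
  · rintro ⟨i, y⟩ he
    rw [Finset.mem_sdiff, Finset.mem_union, Finset.mem_union] at he
    obtain ⟨he, hn⟩ := he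
    push Not at hn
    obtain ⟨⟨n1, n2⟩, n3⟩ := hn
    have hy := (Finset.mem_product.1 he).2
    simp only at hy
    have hyB : y ∈ B := wBall_mono a (by omega) hy
    have hyB' : a i * y ∈ B := gen_mul_mem a i hy
    have g1 : α/2 ≤ g y := by
      by_contra hc
      exact n1 (Finset.mem_filter.2 ⟨he, Finset.mem_filter.2 ⟨hyB, not_le.1 hc⟩⟩)
    have g2 : α/2 ≤ g (a i * y) := by
      by_contra hc
      exact n2 (Finset.mem_filter.2 ⟨he, Finset.mem_filter.2 ⟨hyB', not_le.1 hc⟩⟩)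
    have g3 : ‖u i y * f (a i * y) - f y‖ ≤ α/R := by
      by_contra hc
      exact n3 (Finset.mem_filter.2 ⟨he, not_le.1 hc⟩)
    have p1 : 0 < g y := by linarith
    have p2 : 0 < g (a i * y) := by linarith
    have f1 : f y ≠ 0 := norm_pos_iff.1 p1
    have f2 : f (a i * y) ≠ 0 := norm_pos_iff.1 p2
    simp only [f1, f2, if_false]
    have q1 : (g y : ℂ) ≠ 0 := by exact_mod_cast p1.ne'
    have q2 : (g (a i * y) : ℂ) ≠ 0 := by exact_mod_cast p2.ne'
    have id1 : u i y * (f (a i * y) / (g (a i * y) : ℂ)) - f y / (g y : ℂ) =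
      ((u i y * f (a i * y) - f y) + u i y * (f (a i * y) / (g (a i * y) : ℂ)) * ((g y : ℂ) - (g (a i * y) : ℂ))) / (g y : ℂ) := by
      field_simp; ring
    rw [id1, norm_div]
    have n4 : ‖(g y : ℂ)‖ = g y := by rw [Complex.norm_real, Real.norm_eq_abs, abs_of_pos p1]
    have n5 : ‖u i y * (f (a i * y) / (g (a i * y) : ℂ)) * ((g y : ℂ) - (g (a i * y) : ℂ))‖ ≤ α/R := by
      rw [norm_mul, norm_mul, hu, one_mul, norm_div, Complex.norm_real, ← Complex.ofReal_sub, Complex.norm_real]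
      have : ‖f (a i * y)‖ / ‖g (a i * y)‖ = 1 := by
        rw [Real.norm_eq_abs, abs_of_pos p2]; exact div_self p2.ne'
      rw [this, one_mul]
      have h1 := abs_norm_sub_norm_le (u i y * f (a i * y)) (f y)
      rw [norm_mul, hu, one_mul] at h1
      rw [Real.norm_eq_abs, abs_sub_comm]
      exact h1.trans g3
    rw [n4, div_le_div_iff₀ p1 hRpos]
    have n6 := (norm_add_le (u i y * f (a i * y) - f y) (u i y * (f (a i * y) / (g (a i * y) : ℂ)) * ((g y : ℂ) - (g (a i * y) : ℂ)))).trans (add_le_add g3 n5)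
    calc _ ≤ (α/R + α/R) * R := by gcongr
      _ = 2 * α := by field_simp; ring
      _ ≤ _ := by linarith

end poincare
end part6

section part7

section counting

lemma norm_exp_sub_le (x y : ℝ) : ‖Complex.exp (Complex.I * x) - Complex.exp (Complex.I * y)‖ ≤ |x - y| := by
  have h : Complex.exp (Complex.I * x) - Complex.exp (Complex.I * y) =
      Complex.exp (Complex.I * y) * (Complex.exp (Complex.I * ((x - y : ℝ) : ℂ)) - 1) := by
    rw [mul_sub, ← Complex.exp_add]; congr 2
    · push_cast; ring
    · ring
  have h1 : ‖Complex.exp (Complex.I * y)‖ = 1 := by rw [mul_comm]; exact Complex.norm_exp_ofReal_mul_I y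
  rw [h, norm_mul, h1, one_mul]
  exact Real.norm_exp_I_mul_ofReal_sub_one_le

lemma stdAddChar_exp (m : ℕ) [NeZero m] (j : ℤ) :
    (ZMod.stdAddChar (j : ZMod m) : ℂ) = Complex.exp (Complex.I * ((2 * Real.pi * j / m : ℝ) : ℂ)) := by
  rw [ZMod.stdAddChar_coe]; congr 1; push_cast; ring

lemma round_phase (m : ℕ) [NeZero m] (w : ℂ) (hw : ‖w‖ = 1) :
    ∃ j : ZMod m, ‖w - ZMod.stdAddChar j‖ ≤ 2 * Real.pi / m := by
  have hm : (0:ℝ) < m := by exact_mod_cast Nat.pos_of_ne_zero (NeZero.ne m)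
  set t := Complex.arg w
  have ht : w = Complex.exp (Complex.I * (t:ℂ)) := by
    have := Complex.norm_mul_exp_arg_mul_I w
    rw [hw] at this
    rw [mul_comm Complex.I, ← this]; simp [t]
  have hpi := Real.pi_pos
  refine ⟨((⌊t * m / (2 * Real.pi)⌋ : ℤ) : ZMod m), ?_⟩
  rw [stdAddChar_exp, ht]
  refine (norm_exp_sub_le _ _).trans ?_
  set j := ⌊t * m / (2 * Real.pi)⌋
  have h1 : (j:ℝ) ≤ t * m / (2 * Real.pi) := Int.floor_le _
  have h2 : t * m / (2 * Real.pi) < j + 1 := Int.lt_floor_add_one _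
  have e : t - 2 * Real.pi * j / m = (2 * Real.pi / m) * (t * m / (2 * Real.pi) - j) := by
    field_simp
  rw [e, abs_mul, abs_of_pos (by positivity), abs_of_nonneg (by linarith)]
  calc _ ≤ (2 * Real.pi / m) * 1 := by gcongr; linarith
    _ = _ := by ring

/-- Near-trivial phases. -/
def Wset (m : ℕ) [NeZero m] : Finset (ZMod m) :=
  Finset.univ.filter fun s => ‖(ZMod.stdAddChar s : ℂ) - 1‖ ≤ 17 / m

lemma Wset_card (m : ℕ) [NeZero m] : (Wset m).card ≤ 9 := by
  have hm : (0:ℝ) < m := by exact_mod_cast Nat.pos_of_ne_zero (NeZero.ne m)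
  have h9 : (Finset.Icc (-4:ℤ) 4).card = 9 := by simp
  rw [← h9]
  apply Finset.card_le_card_of_injOn (fun s : ZMod m => s.valMinAbs)
  · intro s hs
    rw [Finset.mem_coe, Wset, Finset.mem_filter] at hs
    have hs := hs.2
    have e : (ZMod.stdAddChar s : ℂ) = Complex.exp (Complex.I * ((2 * Real.pi * s.valMinAbs / m : ℝ) : ℂ)) := by
      rw [← stdAddChar_exp, ZMod.coe_valMinAbs]
    rw [e, Complex.norm_exp_I_mul_ofReal_sub_one, norm_mul, Real.norm_eq_abs, Real.norm_eq_abs, abs_two] at hs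
    have hb := ZMod.valMinAbs_mem_Ioc s
    have hb1 : -(m:ℝ) < s.valMinAbs * 2 := by exact_mod_cast hb.1
    have hb2 : (s.valMinAbs:ℝ) * 2 ≤ m := by exact_mod_cast hb.2
    have hpi := Real.pi_pos
    have habs : |(s.valMinAbs:ℝ)| ≤ m/2 := abs_le.2 ⟨by linarith, by linarith⟩
    have hx : |2 * Real.pi * s.valMinAbs / m / 2| = Real.pi / m * |(s.valMinAbs:ℝ)| := by
      rw [show 2 * Real.pi * s.valMinAbs / m / 2 = Real.pi / m * (s.valMinAbs:ℝ) by ring, abs_mul, abs_of_pos (by positivity)]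
    have hl := Real.mul_abs_le_abs_sin (x := 2 * Real.pi * s.valMinAbs / m / 2) (by
      rw [hx]
      calc _ ≤ Real.pi / m * (m/2) := by gcongr
        _ = _ := by field_simp)
    rw [hx] at hl
    have h1 : 2 / Real.pi * (Real.pi / m * |(s.valMinAbs:ℝ)|) = 2 * |(s.valMinAbs:ℝ)| / m := by field_simp
    rw [h1] at hl
    have h2 : 4 * |(s.valMinAbs:ℝ)| / m ≤ 17 / m := by
      calc _ = 2 * (2 * |(s.valMinAbs:ℝ)| / m) := by ring
        _ ≤ _ := by linarith
    rw [div_le_div_iff_of_pos_right hm] at h2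
    have h3 : |(s.valMinAbs:ℝ)| < 5 := by linarith
    have h4 : |s.valMinAbs| < 5 := by exact_mod_cast h3
    rw [abs_lt] at h4
    rw [Finset.mem_coe, Finset.mem_Icc]
    show -4 ≤ s.valMinAbs ∧ s.valMinAbs ≤ 4
    omega
  · intro s _ t _ h
    exact ZMod.valMinAbs_inj.1 h

variable {X Y : Type*} [Fintype X] [DecidableEq X] [Fintype Y] [DecidableEq Y] (m : ℕ) [NeZero m]

lemma count_set (E : Finset X) (c : X → ZMod m) (W : Finset (ZMod m)) :
    ((Finset.univ.filter fun θ : X → ZMod m => ∀ x ∈ E, θ x - c x ∈ W).card : ℝ) ≤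
      Fintype.card (X → ZMod m) * ((W.card : ℝ) / m)^E.card := by
  have hm : (m:ℝ) ≠ 0 := by exact_mod_cast NeZero.ne m
  let T : X → Finset (ZMod m) := fun x => if x ∈ E then W.image (fun s => s + c x) else Finset.univ
  have h1 : (Finset.univ.filter fun θ : X → ZMod m => ∀ x ∈ E, θ x - c x ∈ W) ⊆ Fintype.piFinset T := by
    intro θ hθ
    rw [Finset.mem_filter] at hθ
    rw [Fintype.mem_piFinset]
    intro x
    simp only [T]
    split_ifs with hx
    · exact Finset.mem_image.2 ⟨θ x - c x, hθ.2 x hx, by simp⟩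
    · exact Finset.mem_univ _
  have h2 := Finset.card_le_card h1
  rw [Fintype.card_piFinset] at h2
  have h3 : ∀ x, ((T x).card : ℝ) ≤ m * (if x ∈ E then (W.card:ℝ)/m else 1) := by
    intro x
    simp only [T]
    split_ifs with hx
    · rw [mul_div_cancel₀ _ hm]
      exact_mod_cast Finset.card_image_le
    · simp [ZMod.card]
  calc _ ≤ ((∏ x, (T x).card : ℕ) : ℝ) := by exact_mod_cast h2
    _ = ∏ x, ((T x).card : ℝ) := by push_cast; rfl
    _ ≤ ∏ x, (m * (if x ∈ E then (W.card:ℝ)/m else 1)) :=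
        Finset.prod_le_prod (fun _ _ => Nat.cast_nonneg _) fun x _ => h3 x
    _ = _ := by
        rw [Finset.prod_mul_distrib, Finset.prod_ite_mem]
        simp [ZMod.card, div_pow]

lemma count_union (E : Finset X) (c : (Y → ZMod m) → X → ZMod m) (W : Finset (ZMod m)) (hW : W.card ≤ 9)
    (hm9 : 9 ≤ m) (q : ℕ) (P : (X → ZMod m) → Prop)
    (h : ∀ θ, P θ → ∃ J ⊆ E, q ≤ (E \ J).card ∧ ∃ ψ : Y → ZMod m, ∀ x ∈ E \ J, θ x - c ψ x ∈ W) :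
    (Nat.card {θ // P θ} : ℝ) ≤ (2^E.card * (m:ℝ)^(Fintype.card Y) * (9/m)^q) * Fintype.card (X → ZMod m) := by
  classical
  have hmpos : (0:ℝ) < m := by positivity
  have hm9' : (9:ℝ) ≤ m := by exact_mod_cast hm9
  let F := (E.powerset.filter fun J => q ≤ (E \ J).card) ×ˢ (Finset.univ : Finset (Y → ZMod m))
  let S : Finset X × (Y → ZMod m) → Finset (X → ZMod m) := fun z =>
    Finset.univ.filter fun θ : X → ZMod m => ∀ x ∈ E \ z.1, θ x - c z.2 x ∈ W
  have h1 : (Finset.univ.filter P) ⊆ F.biUnion S := by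
    intro θ hθ
    obtain ⟨J, hJ, hq, ψ, hψ⟩ := h θ (Finset.mem_filter.1 hθ).2
    refine Finset.mem_biUnion.2 ⟨(J, ψ), ?_, ?_⟩
    · exact Finset.mem_product.2 ⟨Finset.mem_filter.2 ⟨Finset.mem_powerset.2 hJ, hq⟩, Finset.mem_univ _⟩
    · exact Finset.mem_filter.2 ⟨Finset.mem_univ _, hψ⟩
  have h2 : ∀ z ∈ F, ((S z).card : ℝ) ≤ Fintype.card (X → ZMod m) * (9/m)^q := by
    intro z hz
    refine (count_set m (E \ z.1) (c z.2) W).trans ?_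
    have hq := (Finset.mem_filter.1 (Finset.mem_product.1 hz).1).2
    have hW' : (W.card : ℝ) ≤ 9 := by exact_mod_cast hW
    have : ((W.card : ℝ)/m)^(E \ z.1).card ≤ (9/m)^q := by
      calc _ ≤ ((9:ℝ)/m)^(E \ z.1).card := by gcongr
        _ ≤ _ := pow_le_pow_of_le_one (by positivity) ((div_le_one hmpos).2 hm9') hq
    exact mul_le_mul_of_nonneg_left this (Nat.cast_nonneg _)
  have h3 : (F.card : ℝ) ≤ 2^E.card * (m:ℝ)^(Fintype.card Y) := by
    have : F.card ≤ 2^E.card * m^(Fintype.card Y) := by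
      rw [Finset.card_product]
      apply Nat.mul_le_mul
      · exact (Finset.card_filter_le _ _).trans (by rw [Finset.card_powerset])
      · rw [Finset.card_univ]; simp [ZMod.card]
    exact_mod_cast this
  rw [Nat.card_eq_fintype_card, Fintype.card_subtype]
  have h4 : ((Finset.univ.filter P).card : ℝ) ≤ ∑ z ∈ F, ((S z).card : ℝ) := by
    exact_mod_cast (Finset.card_le_card h1).trans Finset.card_biUnion_le
  refine h4.trans ((Finset.sum_le_sum h2).trans ?_)
  rw [Finset.sum_const, nsmul_eq_mul]
  have h5 : (0:ℝ) ≤ Fintype.card (X → ZMod m) * (9/m)^q := by positivity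
  refine (mul_le_mul_of_nonneg_right h3 h5).trans (le_of_eq ?_)
  ring

end counting

section upper
variable {r : ℕ} {G : Type*} [Group G] [DecidableEq G] (a : Fin r → G)

lemma bad_count (hr : 2 ≤ r) (R0 n : ℕ) {K : ℝ} (hK1 : 1 ≤ K)
    (hK : ((wBall a (2*(R0+1))).card : ℝ) ≤ K * (wBall a (R0+1)).card)
    (hR9 : 9 ≤ R0+1) (hgr : 3 * (wBall a (R0+1)).card ≤ 4 * (wBall a R0).card)
    (x : G) (hx : x ∈ wBall a n) :
    (Nat.card {θ : Fin r × (wBall a (R0+1+n)) → ZMod (R0+1) //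
        ¬ GoodAt a (phu (R0+1) (wBall a (R0+1+n)) θ) (R0+1) ((1/(1024*K))/((R0+1:ℕ):ℝ)^2) x} : ℝ) ≤
      (15116544/((R0+1:ℕ):ℝ))^(((wBall a (R0+1)).card+3)/4) *
        Fintype.card (Fin r × (wBall a (R0+1+n)) → ZMod (R0+1)) := by
  set m := R0+1 with hm
  set Λ := wBall a (m+n) with hΛ
  obtain ⟨I, -, hI⟩ := Finset.exists_subset_card_eq (s := (Finset.univ : Finset (Fin r))) (n := 2) (by simpa using hr)
  set b := (wBall a m).card with hb
  let pull : Finset (Fin r × G) → Finset (Fin r × Λ) := fun A =>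
    Finset.univ.filter fun e => (e.1, e.2.1 * x⁻¹) ∈ A
  have hxΛ : ∀ y ∈ wBall a m, y * x ∈ Λ := fun y hy => mul_mem_ball a hy hx
  have hpull : ∀ A ⊆ I ×ˢ wBall a R0, (pull A).card = A.card := by
    intro A hA
    apply Finset.card_bij (fun e _ => (e.1, e.2.1 * x⁻¹))
    · intro e he; exact (Finset.mem_filter.1 he).2
    · rintro ⟨i, y, hy⟩ _ ⟨j, z, hz⟩ _ h
      simp only [Prod.mk.injEq, mul_left_inj] at h
      obtain ⟨rfl, rfl⟩ := h
      rfl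
    · rintro ⟨i, y⟩ hy
      have hy' := (Finset.mem_product.1 (hA hy)).2
      refine ⟨(i, ⟨y * x, hxΛ y (wBall_mono a (by omega) hy')⟩), ?_, by simp⟩
      simp only [pull, Finset.mem_filter, Finset.mem_univ, true_and, mul_inv_cancel_right]
      exact hy
  set E := pull (I ×ˢ wBall a R0) with hE
  have hEcard : E.card = 2 * (wBall a R0).card := by
    rw [hE, hpull _ (Finset.Subset.refl _), Finset.card_product, hI]
  have hb0 : (wBall a R0).card ≤ b := Finset.card_le_card (wBall_mono a (by omega))
  let c : (wBall a m → ZMod m) → (Fin r × Λ) → ZMod m := fun ψ e =>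
    if h : e.2.1 * x⁻¹ ∈ wBall a m ∧ a e.1 * (e.2.1 * x⁻¹) ∈ wBall a m then
      ψ ⟨_, h.1⟩ - ψ ⟨_, h.2⟩ else 0
  have hmpos : (0:ℝ) < (m:ℝ) := by positivity
  have key := count_union m E c (Wset m) (Wset_card m) hR9 (b + (b+3)/4)
    (fun θ => ¬ GoodAt a (phu m Λ θ) m ((1/(1024*K))/((m:ℕ):ℝ)^2) x) ?_
  · refine key.trans ?_
    apply mul_le_mul_of_nonneg_right _ (Nat.cast_nonneg _)
    rw [Fintype.card_coe, ← hb]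
    set q := (b+3)/4 with hq
    have h1 : (2:ℝ)^E.card ≤ 4^b := by
      rw [show (4:ℝ) = 2^2 by norm_num, ← pow_mul]
      exact pow_le_pow_right₀ (by norm_num) (by rw [hEcard]; omega)
    have h2 : (36:ℝ)^b ≤ (36^4)^q := by
      rw [← pow_mul]
      exact pow_le_pow_right₀ (by norm_num) (by omega)
    calc _ ≤ (4:ℝ)^b * (m:ℝ)^b * (9/m)^(b+q) := by gcongr
      _ = 36^b * (9/m)^q := by
          rw [pow_add, ← mul_pow, ← mul_assoc, ← mul_pow]
          congr 2
          field_simp; norm_num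
      _ ≤ (36^4)^q * (9/m)^q := by gcongr
      _ = _ := by rw [← mul_pow]; congr 1; ring
  · intro θ hθ
    unfold GoodAt at hθ
    push Not at hθ
    obtain ⟨f, hf⟩ := hθ
    obtain ⟨J, hJ, hJc, w, hw, hstr⟩ := bad_struct a I hI R0 hK1 hK (fun i y => phu m Λ θ i (y * x))
      (fun i y => phu_norm m Λ θ i _) (fun y => f (y * x)) (by
        refine lt_of_le_of_lt (le_of_eq ?_) hf
        refine Finset.sum_congr rfl fun y _ => ?_
        simp only [eng, mul_assoc])
    have hsd : E \ pull J = pull ((I ×ˢ wBall a R0) \ J) := by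
      ext e
      simp [pull, hE]
    have hsub : pull J ⊆ E := by
      intro e he
      rw [hE]
      exact Finset.mem_filter.2 ⟨Finset.mem_univ _, hJ (Finset.mem_filter.1 he).2⟩
    refine ⟨pull J, hsub, ?_, ?_⟩
    · rw [Finset.card_sdiff_of_subset hsub, hpull J hJ, hEcard]
      have hJc' : 4 * J.card ≤ b := hJc
      have hgr' : 3 * b ≤ 4 * (wBall a R0).card := hgr
      omega
    · choose ψ hψ using fun y => round_phase m (w y) (hw y)
      refine ⟨fun y => ψ y.1, ?_⟩
      rintro ⟨i, z, hz⟩ he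
      rw [hsd] at he
      have he := (Finset.mem_filter.1 he).2
      simp only at he
      have h1 := hstr _ he
      have hy := (Finset.mem_product.1 (Finset.mem_sdiff.1 he).1).2
      simp only at h1 hy
      have hc : (z * x⁻¹ ∈ wBall a m ∧ a i * (z * x⁻¹) ∈ wBall a m) :=
        ⟨wBall_mono a (by omega) hy, gen_mul_mem a i hy⟩
      simp only [c, hc, and_self, dite_true]
      rw [inv_mul_cancel_right] at h1
      have hphu : phu m Λ θ i z = ZMod.stdAddChar (θ (i, ⟨z, hz⟩)) := by simp [phu, hz]
      rw [hphu] at h1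
      set y := z * x⁻¹
      set t := θ (i, ⟨z, hz⟩)
      rw [Wset, Finset.mem_filter]
      refine ⟨Finset.mem_univ _, ?_⟩
      have hn : ∀ s : ZMod m, ‖(ZMod.stdAddChar s : ℂ)‖ = 1 := fun s => AddChar.norm_apply _ _
      have e1 : (ZMod.stdAddChar (t - (ψ y - ψ (a i * y))) : ℂ) - 1 =
          ZMod.stdAddChar (-ψ y) * (ZMod.stdAddChar t * ZMod.stdAddChar (ψ (a i * y)) - ZMod.stdAddChar (ψ y)) := by
        rw [mul_sub, ← AddChar.map_add_eq_mul, ← AddChar.map_add_eq_mul, ← AddChar.map_add_eq_mul, neg_add_cancel,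
          AddChar.map_zero_eq_one]
        congr 2; ring
      rw [e1, norm_mul, hn, one_mul]
      have e2 : (ZMod.stdAddChar t * ZMod.stdAddChar (ψ (a i * y)) - ZMod.stdAddChar (ψ y) : ℂ) =
        (ZMod.stdAddChar t * w (a i * y) - w y) + (w y - ZMod.stdAddChar (ψ y)) -
          ZMod.stdAddChar t * (w (a i * y) - ZMod.stdAddChar (ψ (a i * y))) := by ring
      rw [e2]
      refine (norm_sub_le _ _).trans ?_
      rw [norm_mul, hn, one_mul]
      have e3 := norm_add_le (ZMod.stdAddChar t * w (a i * y) - w y) (w y - ZMod.stdAddChar (ψ y))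
      have e4 := hψ y
      have e5 := hψ (a i * y)
      have e6 : 4/(m:ℝ) + 2 * Real.pi/m + 2*Real.pi/m ≤ 17/m := by
        rw [← add_div, ← add_div, div_le_div_iff_of_pos_right hmpos]
        linarith [Real.pi_lt_d2]
      linarith

/-- Upper bound for the return probability. -/
theorem upper_main (hr : 2 ≤ r) (R0 n : ℕ) {K : ℝ} (hK1 : 1 ≤ K)
    (hK : ∀ R R' : ℕ, 1 ≤ R → R' ≤ 4*R → ((wBall a R').card : ℝ) ≤ K * (wBall a R).card)
    (hR9 : 9 ≤ R0+1) (hgr : 3 * (wBall a (R0+1)).card ≤ 4 * (wBall a R0).card) :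
    ((avgL (fun i => (QuotientGroup.mk (FreeGroup.of i) :
        FreeGroup (Fin r) ⧸ ⁅(FreeGroup.lift a).ker, (FreeGroup.lift a).ker⁆)))^(2*n)) (dl 1) 1 ≤
    (1 - (1/(8192*r*K^2))/((R0+1:ℕ):ℝ)^2)^n +
      (wBall a (2*n+(R0+1))).card * (15116544/((R0+1:ℕ):ℝ))^(((wBall a (R0+1)).card+3)/4) := by
  have hr0 : r ≠ 0 := by omega
  have hr1 : (1:ℝ) ≤ r := by exact_mod_cast (by omega : 1 ≤ r)
  have hm1 : (1:ℝ) ≤ ((R0+1:ℕ):ℝ) := by exact_mod_cast (by omega : 1 ≤ R0+1)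
  have hK0 : 0 < K := by linarith
  have e : (1/(1024*K))/((R0+1:ℕ):ℝ)^2 / (8*r*K) = (1/(8192*r*K^2))/((R0+1:ℕ):ℝ)^2 := by
    field_simp; norm_num
  have := upper_of_bad a hr0 (R0+1) (wBall a (R0+1+(2*n+(R0+1)))) (R := R0+1) (n := n)
    (κ := (1/(1024*K))/((R0+1:ℕ):ℝ)^2) (K := K) (δ := (15116544/((R0+1:ℕ):ℝ))^(((wBall a (R0+1)).card+3)/4))
    (by positivity) hK0 (hK _ _ (by omega) (by omega)) ?_ ?_
  · rwa [e] at this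
  · rw [e, div_div, div_le_one (by positivity)]
    have h1 : 1 ≤ K^2 := one_le_pow₀ hK1
    have h2 : 1 ≤ ((R0+1:ℕ):ℝ)^2 := one_le_pow₀ hm1
    calc (1:ℝ) ≤ 8192 * 1 * 1 * 1 := by norm_num
      _ ≤ _ := by gcongr
  · intro x hx
    exact bad_count a hr R0 (2*n+(R0+1)) hK1 (hK _ _ (by omega) (by omega)) hR9 hgr x hx

end upper
end part7

section part8

lemma finish_const (p Φ : ℕ → ℝ) (hΦ : ∀ n, 2 ≤ n → 0 < Φ n) (hp : ∀ n, 2 ≤ n → 0 < p n)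
    (hp1 : ∀ n, 2 ≤ n → p n < 1) (C1 c1 : ℝ) (hC1 : 0 < C1) (hc1 : 0 < c1) (n0 : ℕ)
    (h1 : ∀ n, n0 ≤ n → Real.exp (-(C1 * Φ n)) ≤ p n)
    (h2 : ∀ n, n0 ≤ n → p n ≤ Real.exp (-(c1 * Φ n))) :
    ∃ C : ℝ, 1 ≤ C ∧ ∀ n, 2 ≤ n → Real.exp (-(C * Φ n)) ≤ p n ∧
      p n ≤ Real.exp (-((1/C) * Φ n)) := by
  set f : ℕ → ℝ := fun n => |(-Real.log (p n)) / Φ n| + |Φ n / (-Real.log (p n))| with hf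
  have hf0 : ∀ n, 0 ≤ f n := fun n => by simp only [hf]; positivity
  set S := ∑ n ∈ Finset.range n0, f n with hS
  have hS0 : 0 ≤ S := Finset.sum_nonneg fun n _ => hf0 n
  have hCpos : 0 < 1 + C1 + 1/c1 + S := by positivity
  refine ⟨1 + C1 + 1/c1 + S, by have : 0 < 1/c1 := by positivity
                                linarith, fun n hn => ?_⟩
  have hΦn := hΦ n hn
  have hc1' : 0 < 1/c1 := by positivity
  by_cases hn0 : n0 ≤ n
  · refine ⟨le_trans (Real.exp_le_exp.2 ?_) (h1 n hn0), le_trans (h2 n hn0) (Real.exp_le_exp.2 ?_)⟩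
    · have : C1 * Φ n ≤ (1 + C1 + 1/c1 + S) * Φ n := by gcongr; linarith
      linarith
    · have h3 : 1/(1 + C1 + 1/c1 + S) ≤ c1 := by
        rw [div_le_iff₀ hCpos]
        have : c1 * (1/c1) = 1 := by field_simp
        nlinarith [mul_nonneg hc1.le hS0, mul_pos hc1 hC1]
      have : 1/(1 + C1 + 1/c1 + S) * Φ n ≤ c1 * Φ n := by gcongr
      linarith
  · have hfn : f n ≤ S := Finset.single_le_sum (f := f) (fun n _ => hf0 n)
      (Finset.mem_range.2 (not_le.1 hn0))
    have hl : 0 < -Real.log (p n) := by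
      have := Real.log_neg (hp n hn) (hp1 n hn); linarith
    have hA : (-Real.log (p n)) / Φ n ≤ f n :=
      (le_abs_self _).trans (by simp only [hf]; exact le_add_of_nonneg_right (abs_nonneg _))
    have hB : Φ n / (-Real.log (p n)) ≤ f n :=
      (le_abs_self _).trans (by simp only [hf]; exact le_add_of_nonneg_left (abs_nonneg _))
    have hA' : (-Real.log (p n)) / Φ n ≤ 1 + C1 + 1/c1 + S := by linarith
    have hB' : Φ n / (-Real.log (p n)) ≤ 1 + C1 + 1/c1 + S := by linarith
    rw [div_le_iff₀ hΦn] at hA'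
    rw [div_le_iff₀ hl] at hB'
    constructor
    · rw [← Real.le_log_iff_exp_le (hp n hn)]; linarith
    · rw [← Real.log_le_iff_le_exp (hp n hn)]
      have : 1/(1 + C1 + 1/c1 + S) * Φ n ≤ -Real.log (p n) := by
        rw [one_div_mul_eq_div, div_le_iff₀ hCpos]; linarith
      linarith

/-- the optimal scale -/
def scl (D n : ℕ) : ℝ := ((n:ℝ) / Real.log n) ^ ((1:ℝ) / (2 + (D:ℝ)))

def phiF (D n : ℕ) : ℝ := (n : ℝ) ^ ((D : ℝ) / (2 + (D : ℝ))) *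
          (Real.log n) ^ ((2 : ℝ) / (2 + (D : ℝ)))

lemma log_pos_of {n : ℕ} (hn : 2 ≤ n) : 0 < Real.log n :=
  Real.log_pos (by exact_mod_cast hn)

lemma scl_pos (D : ℕ) {n : ℕ} (hn : 2 ≤ n) : 0 < scl D n := by
  have := log_pos_of hn
  have : (0:ℝ) < n := by positivity
  unfold scl; positivity

lemma phiF_pos (D : ℕ) {n : ℕ} (hn : 2 ≤ n) : 0 < phiF D n := by
  have := log_pos_of hn
  have : (0:ℝ) < n := by positivity
  unfold phiF; positivity

lemma log_scl (D : ℕ) {n : ℕ} (hn : 2 ≤ n) :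
    Real.log (scl D n) = (Real.log n - Real.log (Real.log n)) / (2 + D) := by
  have h1 := log_pos_of hn
  have h2 : (0:ℝ) < n := by positivity
  unfold scl
  rw [Real.log_rpow (by positivity), Real.log_div h2.ne' h1.ne']
  ring

lemma log_phiF (D : ℕ) {n : ℕ} (hn : 2 ≤ n) :
    Real.log (phiF D n) = (D * Real.log n + 2 * Real.log (Real.log n)) / (2 + D) := by
  have h1 := log_pos_of hn
  have h2 : (0:ℝ) < n := by positivity
  unfold phiF
  rw [Real.log_mul (by positivity) (by positivity), Real.log_rpow h2, Real.log_rpow h1]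
  ring

lemma phiF_eq (D : ℕ) {n : ℕ} (hn : 2 ≤ n) : phiF D n = (scl D n)^D * Real.log n := by
  have h1 := log_pos_of hn
  have hx := scl_pos D hn
  apply Real.log_injOn_pos (phiF_pos D hn) (Set.mem_Ioi.2 (by positivity))
  rw [log_phiF D hn, Real.log_mul (by positivity) h1.ne', Real.log_pow, log_scl D hn]
  field_simp; ring

lemma phiF_scl (D : ℕ) {n : ℕ} (hn : 2 ≤ n) : phiF D n * (scl D n)^2 = n := by
  have hx := scl_pos D hn
  have hP := phiF_pos D hn
  have h2 : (0:ℝ) < n := by positivity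
  apply Real.log_injOn_pos (Set.mem_Ioi.2 (by positivity)) h2
  rw [Real.log_mul hP.ne' (by positivity), Real.log_pow, log_phiF D hn, log_scl D hn]
  field_simp; push_cast; ring

lemma log_scl_ge (D : ℕ) {n : ℕ} (hn : 2 ≤ n) :
    Real.log n / (2 * (2 + D)) ≤ Real.log (scl D n) := by
  have h1 := log_pos_of hn
  rw [log_scl D hn, ← div_div]
  gcongr
  have h3 := Real.log_le_sub_one_of_pos (x := Real.log n / 2) (by positivity)
  rw [Real.log_div h1.ne' (by norm_num)] at h3
  have := Real.log_two_lt_d9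
  linarith

lemma scl_tendsto (D : ℕ) : Filter.Tendsto (scl D) Filter.atTop Filter.atTop := by
  unfold scl
  have h1 : Filter.Tendsto (fun n : ℕ => Real.log n / (2 * (2 + (D:ℝ)))) Filter.atTop Filter.atTop :=
    (Real.tendsto_log_atTop.comp tendsto_natCast_atTop_atTop).atTop_div_const (by positivity)
  have h2 : Filter.Tendsto (fun n => Real.log (scl D n)) Filter.atTop Filter.atTop := by
    refine Filter.tendsto_atTop_mono' _ ?_ h1
    filter_upwards [Filter.eventually_ge_atTop 2] with n hn using log_scl_ge D hn
  have h3 := Real.tendsto_exp_atTop.comp h2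
  refine h3.congr' ?_
  filter_upwards [Filter.eventually_ge_atTop 2] with n hn
  exact Real.exp_log (scl_pos D hn)

lemma scl_le (D : ℕ) {n : ℕ} (hn : 3 ≤ n) : scl D n ≤ n := by
  have hn2 : 2 ≤ n := by omega
  have hx := scl_pos D hn2
  have h2 : (0:ℝ) < n := by positivity
  have hL : 1 ≤ Real.log n := by
    rw [Real.le_log_iff_exp_le h2]
    have := Real.exp_one_lt_d9
    have : (3:ℝ) ≤ n := by exact_mod_cast hn
    linarith
  rw [← Real.log_le_log_iff hx h2, log_scl D hn2]
  have : 0 ≤ Real.log (Real.log n) := Real.log_nonneg hL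
  rw [div_le_iff₀ (by positivity)]
  nlinarith [Nat.cast_nonneg (α := ℝ) D]

lemma one_le_log {n : ℕ} (hn : 3 ≤ n) : 1 ≤ Real.log n := by
  have h2 : (0:ℝ) < n := by positivity
  rw [Real.le_log_iff_exp_le h2]
  have := Real.exp_one_lt_d9
  have : (3:ℝ) ≤ n := by exact_mod_cast hn
  linarith

set_option maxHeartbeats 1000000 in
lemma lower_asym {n D r R V : ℕ} (hn : 3 ≤ n) {K C p : ℝ} (hK : 1 ≤ K) (hC : 0 < C) (hp : 0 ≤ p)
    (hx2 : 2 ≤ scl D n) (hxK : 2 * K ≤ scl D n) (hR1 : scl D n ≤ R) (hR2 : (R:ℝ) ≤ scl D n + 1)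
    (hV : (V:ℝ) ≤ C * ((R+1:ℕ):ℝ)^D)
    (h : ((1 - K/(R:ℝ)^2)^n/(R+1))^2 ≤ ((V:ℝ)*(2*n+1)^(r*V)) * p) :
    Real.exp (-((4*K+4+(1+3*r)*(C*2^D)) * phiF D n)) ≤ p := by
  have hn2 : 2 ≤ n := by omega
  have hn3 : (3:ℝ) ≤ n := by exact_mod_cast hn
  set x := scl D n with hx
  set L := Real.log n with hL
  set P := phiF D n with hP
  have hL1 : 1 ≤ L := one_le_log hn
  have hxn : x ≤ n := scl_le D hn
  have hPe : P = x^D * L := phiF_eq D hn2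
  have hPx : P * x^2 = n := phiF_scl D hn2
  have hx0 : 0 < x := by linarith
  have hP0 : 0 < P := phiF_pos D hn2
  have hexpL : Real.exp L = n := Real.exp_log (by linarith)
  have hLP : L ≤ P := by
    rw [hPe]; exact le_mul_of_one_le_left (by linarith) (one_le_pow₀ (by linarith))
  have hV1 : (V:ℝ) ≤ C*2^D*x^D := by
    refine hV.trans ?_
    rw [mul_assoc, ← mul_pow]
    push_cast
    gcongr
    linarith
  have hVL : (V:ℝ)*L ≤ C*2^D*P := by
    rw [hPe, ← mul_assoc]; gcongr
  have hV0 : (0:ℝ) ≤ V := Nat.cast_nonneg _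
  have hVP : (V:ℝ) ≤ C*2^D*P := le_trans (le_mul_of_one_le_right hV0 hL1) hVL
  -- first factor
  have ha : K/(R:ℝ)^2 ≤ K/x^2 := by gcongr
  have hb : K/x^2 ≤ 1/2 := by
    rw [div_le_div_iff₀ (by positivity) (by norm_num)]; nlinarith
  have hlow1 : Real.exp (-(2*(K/x^2))) ≤ 1 - K/(R:ℝ)^2 := by
    set t := K/x^2
    have ht : 0 ≤ t := by positivity
    have h1 : Real.exp (-(2*t)) ≤ 1 - t := by
      rw [Real.exp_neg, inv_le_comm₀ (Real.exp_pos _) (by linarith)]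
      refine le_trans ?_ (Real.add_one_le_exp _)
      rw [inv_le_iff_one_le_mul₀ (by linarith)]
      nlinarith
    linarith
  have hlow2 : Real.exp (-(2*K*P)) ≤ (1 - K/(R:ℝ)^2)^n := by
    have := pow_le_pow_left₀ (Real.exp_pos _).le hlow1 n
    rw [← Real.exp_nat_mul] at this
    refine le_trans (le_of_eq ?_) this
    congr 1
    rw [← hPx]; field_simp
  have hR3 : (R:ℝ)+1 ≤ Real.exp (2*L) := by
    rw [two_mul, Real.exp_add, hexpL]; nlinarith
  have hlow3 : Real.exp (-(2*K*P) - 2*L) ≤ (1 - K/(R:ℝ)^2)^n/(R+1) := by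
    rw [Real.exp_sub]
    have : (0:ℝ) < (R:ℝ)+1 := by positivity
    exact div_le_div₀ ((Real.exp_pos _).le.trans hlow2) hlow2 this hR3
  have hlow4 : Real.exp (-(4*K*P) - 4*L) ≤ ((1 - K/(R:ℝ)^2)^n/(R+1))^2 := by
    have := pow_le_pow_left₀ (Real.exp_pos _).le hlow3 2
    rw [← Real.exp_nat_mul] at this
    refine le_trans (le_of_eq ?_) this
    congr 1; push_cast; ring
  have hup : ((V:ℝ)*(2*n+1)^(r*V)) ≤ Real.exp (V + 3*r*(V*L)) := by
    rw [Real.exp_add]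
    have h1 : (2*n+1:ℝ) ≤ Real.exp (3*L) := by
      rw [show 3*L = L+L+L by ring, Real.exp_add, Real.exp_add, hexpL]
      nlinarith [mul_self_nonneg ((n:ℝ)-3), mul_nonneg (show (0:ℝ) ≤ n by linarith) (show (0:ℝ) ≤ n-3 by linarith), mul_nonneg (mul_self_nonneg (n:ℝ)) (show (0:ℝ) ≤ n-3 by linarith)]
    have h2 : (2*n+1:ℝ)^(r*V) ≤ Real.exp (3*r*(V*L)) := by
      have := pow_le_pow_left₀ (by positivity) h1 (r*V)
      rw [← Real.exp_nat_mul] at this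
      refine this.trans (le_of_eq ?_)
      congr 1; push_cast; ring
    have h3 : (V:ℝ) ≤ Real.exp V := by linarith [Real.add_one_le_exp (V:ℝ)]
    gcongr
  have hfin : Real.exp (-(4*K*P) - 4*L) ≤ Real.exp (V + 3*r*(V*L)) * p :=
    hlow4.trans (h.trans (mul_le_mul_of_nonneg_right hup hp))
  have hfin2 : Real.exp (-(4*K*P) - 4*L - (V + 3*r*(V*L))) ≤ p := by
    rw [Real.exp_sub, div_le_iff₀ (Real.exp_pos _)]; linarith only [hfin]
  refine le_trans (Real.exp_le_exp.2 ?_) hfin2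
  have : 3*r*(V*L) ≤ 3*r*(C*2^D*P) := by gcongr
  linarith only [this, hVP, hLP]

set_option maxHeartbeats 1000000 in
lemma upper_asym {n D m V q : ℕ} (hn : 3 ≤ n) {A ε c C p : ℝ} (hD : 1 ≤ D) (hε : 0 < ε)
    (hε1 : ε ≤ 1) (hc : 0 < c) (hC : 0 < C) (hA : 0 < A) (hx1 : 1 ≤ scl D n) (hxA : A^2 ≤ scl D n)
    {d : ℝ} (hd : d = c / (16*(2+D)))
    (hx2 : 2*(C+4*D)/d ≤ scl D n)
    {e : ℝ} (he : 0 < e) (he1 : e ≤ ε/16) (he2 : e ≤ d/2) (hx3 : 2/e ≤ scl D n)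
    (hm1 : scl D n ≤ m) (hm2 : (m:ℝ) ≤ 4 * scl D n)
    (hV : (V:ℝ) ≤ C * ((2*n+m:ℕ):ℝ)^D) (hq : c * (m:ℝ)^D / 4 ≤ q)
    (h : p ≤ (1 - ε/(m:ℝ)^2)^n + V * (A/(m:ℝ))^q) :
    p ≤ Real.exp (-(e/2 * phiF D n)) := by
  have hn2 : 2 ≤ n := by omega
  have hn3 : (3:ℝ) ≤ n := by exact_mod_cast hn
  set x := scl D n with hx
  set L := Real.log n with hL
  set P := phiF D n with hP
  have hL1 : 1 ≤ L := one_le_log hn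
  have hxn : x ≤ n := scl_le D hn
  have hPe : P = x^D * L := phiF_eq D hn2
  have hPx : P * x^2 = n := phiF_scl D hn2
  have hx0 : 0 < x := by linarith
  have hP0 : 0 < P := phiF_pos D hn2
  have hexpL : Real.exp L = n := Real.exp_log (by linarith)
  have hxD : x ≤ x^D := le_self_pow₀ hx1 (by omega)
  have hm0 : (0:ℝ) < m := by linarith
  have hd0 : 0 < d := by rw [hd]; positivity
  -- first
  have h1 : (1 - ε/(m:ℝ)^2)^n ≤ Real.exp (-(e*P)) := by
    have hm1' : ε/(m:ℝ)^2 ≤ 1 := by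
      rw [div_le_one (by positivity)]
      nlinarith
    have ha : 1 - ε/(m:ℝ)^2 ≤ Real.exp (-(ε/(16*x^2))) := by
      have h2 : ε/(16*x^2) ≤ ε/(m:ℝ)^2 := by
        gcongr
        calc (m:ℝ)^2 ≤ (4*x)^2 := by gcongr
          _ = _ := by ring
      have := Real.add_one_le_exp (-(ε/(16*x^2)))
      linarith
    have := pow_le_pow_left₀ (by linarith) ha n
    rw [← Real.exp_nat_mul] at this
    refine this.trans (Real.exp_le_exp.2 ?_)
    rw [← hPx]
    have : P * x^2 * -(ε/(16*x^2)) = -(ε/16*P) := by field_simp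
    rw [this]
    have : e * P ≤ ε/16*P := by gcongr
    linarith
  have h2 : (A/(m:ℝ))^q ≤ Real.exp (-(d*P)) := by
    have ha : A/(m:ℝ) ≤ Real.exp (-(Real.log x / 2)) := by
      have hs : Real.exp (Real.log x / 2) * Real.exp (Real.log x / 2) = x := by
        rw [← Real.exp_add, add_halves, Real.exp_log hx0]
      set s := Real.exp (Real.log x / 2) with hsd
      have hs0 : 0 < s := Real.exp_pos _
      have hAs : A ≤ s := by nlinarith only [hs, hxA, hs0, hA]
      rw [Real.exp_neg, ← hsd, div_le_iff₀ hm0, inv_mul_eq_div, le_div_iff₀ hs0]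
      nlinarith only [hAs, hs0, hs, hm1]
    have := pow_le_pow_left₀ (by positivity) ha q
    rw [← Real.exp_nat_mul] at this
    refine this.trans (Real.exp_le_exp.2 ?_)
    have hl := log_scl_ge D hn2
    rw [← hL, ← hx] at hl
    have hq2 : c * x^D/4 ≤ q := le_trans (by gcongr) hq
    have hl0 : 0 ≤ L / (2*(2+D)) := by positivity
    have : d * P ≤ q * (Real.log x / 2) := by
      calc d * P = (c*x^D/4) * ((L/(2*(2+D)))/2) := by rw [hd, hPe]; field_simp; ring
        _ ≤ q * (Real.log x/2) := by gcongr
    linarith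
  have h3 : (V:ℝ) ≤ Real.exp (d/2*P) := by
    have ha : ((2*n+m:ℕ):ℝ) ≤ Real.exp (4*L) := by
      rw [show 4*L = L+L+L+L by ring, Real.exp_add, Real.exp_add, Real.exp_add, hexpL]
      push_cast
      have : (m:ℝ) ≤ 4*n := by linarith
      have h9 : (9:ℝ) ≤ n*n := by nlinarith only [hn3]
      have h27 : (27:ℝ) ≤ n*n*n := by nlinarith only [hn3, h9]
      nlinarith only [h27, hn3, this]
    have hb : ((2*n+m:ℕ):ℝ)^D ≤ Real.exp (4*D*L) := by
      have := pow_le_pow_left₀ (Nat.cast_nonneg _) ha D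
      rw [← Real.exp_nat_mul] at this
      refine this.trans (le_of_eq ?_)
      congr 1; ring
    have hc' : C ≤ Real.exp (C*L) := by
      have := Real.add_one_le_exp (C*L)
      nlinarith only [this, hC, hL1]
    calc (V:ℝ) ≤ C * ((2*n+m:ℕ):ℝ)^D := hV
      _ ≤ Real.exp (C*L) * Real.exp (4*D*L) := by gcongr
      _ = Real.exp ((C+4*D)*L) := by rw [← Real.exp_add]; ring_nf
      _ ≤ _ := by
        apply Real.exp_le_exp.2
        rw [hPe, ← mul_assoc]
        gcongr
        rw [div_le_iff₀ hd0] at hx2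
        have : x * d ≤ x^D * d := by gcongr
        linarith only [this, hx2]
  have h4 : V * (A/(m:ℝ))^q ≤ Real.exp (-(e*P)) := by
    calc V * (A/(m:ℝ))^q ≤ Real.exp (d/2*P) * Real.exp (-(d*P)) := by gcongr
      _ = Real.exp (-(d/2*P)) := by rw [← Real.exp_add]; ring_nf
      _ ≤ _ := by
        apply Real.exp_le_exp.2
        have : e * P ≤ d/2*P := by gcongr
        linarith
  have h5 : (2:ℝ) ≤ Real.exp (e/2*P) := by
    have h6 : 1 ≤ e/2*P := by
      rw [div_le_iff₀ he] at hx3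
      have : x ≤ P := by rw [hPe]; nlinarith only [hxD, hL1, hx0]
      nlinarith only [this, hx3, he]
    linarith [Real.add_one_le_exp (e/2*P)]
  calc p ≤ 2 * Real.exp (-(e*P)) := by linarith
    _ ≤ Real.exp (e/2*P) * Real.exp (-(e*P)) := by gcongr
    _ = _ := by rw [← Real.exp_add]; ring_nf

end part8

section part9

lemma closure_of_series {G : Type*} [Group G] (r : ℕ) (H : Fin (r + 1) → Subgroup G)
    (htop : H 0 = ⊤) (hbot : H (Fin.last r) = ⊥) (a : Fin r → G)
    (hcyclic : ∀ i : Fin r, ∀ g ∈ H i.castSucc, ∃ n : ℤ, ((a i) ^ n)⁻¹ * g ∈ H i.succ) :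
    Subgroup.closure (Set.range a) = ⊤ := by
  have key : ∀ i : Fin (r+1), H i ≤ Subgroup.closure (Set.range a) := by
    intro i
    induction i using Fin.reverseInduction with
    | last => rw [hbot]; exact bot_le
    | cast i ih =>
      intro g hg
      obtain ⟨n, hn⟩ := hcyclic i g hg
      have h1 := Subgroup.mul_mem _ (Subgroup.zpow_mem _ (Subgroup.subset_closure (Set.mem_range_self i)) n) (ih hn)
      simpa using h1
  have := key 0
  rw [htop] at this
  exact top_le_iff.1 this

lemma D_pos {r : ℕ} {G : Type*} [Group G] [DecidableEq G] [Infinite G] (a : Fin r → G)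
    (hgen : Subgroup.closure (Set.range a) = ⊤) {D : ℕ} {c C : ℝ} (h : VolB a D c C) : 1 ≤ D := by
  by_contra hD
  have hD0 : D = 0 := by omega
  subst hD0
  obtain ⟨N, hN⟩ := exists_nat_gt C
  obtain ⟨T, hT⟩ := Infinite.exists_subset_card_eq G N
  choose f hf using exists_mem_ball a hgen
  have hsub : T ⊆ wBall a (T.sup f + 1) := by
    intro x hx
    have := Finset.le_sup (f := f) hx
    exact wBall_mono a (by omega) (hf x)
  have h1 := (h.2.2 (T.sup f + 1) (by omega)).2
  have h2 := Finset.card_le_card hsub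
  rw [hT] at h2
  have h3 : (N:ℝ) ≤ (wBall a (T.sup f + 1)).card := by exact_mod_cast h2
  rw [pow_zero, mul_one] at h1
  linarith

theorem main_asym {G : Type*} [Group G] [Infinite G] [DecidableEq G] (r : ℕ) (hr : 2 ≤ r)
    (a : Fin r → G) (hgen : Subgroup.closure (Set.range a) = ⊤) (D : ℕ) (hpoly : HasPolyGrowth G D) :
    ∃ C : ℝ, 1 ≤ C ∧ ∀ n, 2 ≤ n →
      Real.exp (-(C * phiF D n)) ≤ ((avgL (fun i => (QuotientGroup.mk (FreeGroup.of i) :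
        FreeGroup (Fin r) ⧸ ⁅(FreeGroup.lift a).ker, (FreeGroup.lift a).ker⁆)))^(2*n)) (dl 1) 1 ∧
      ((avgL (fun i => (QuotientGroup.mk (FreeGroup.of i) :
        FreeGroup (Fin r) ⧸ ⁅(FreeGroup.lift a).ker, (FreeGroup.lift a).ker⁆)))^(2*n)) (dl 1) 1 ≤
        Real.exp (-((1/C) * phiF D n)) := by
  set s : Fin r → FreeGroup (Fin r) ⧸ ⁅(FreeGroup.lift a).ker, (FreeGroup.lift a).ker⁆ :=
    fun i => QuotientGroup.mk (FreeGroup.of i) with hs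
  have hps : ∀ i, projM a (s i) = a i := fun i => by simp [hs, projM_mk]
  have hsurj : Function.Surjective (projM a) := by
    intro g
    have h1 : g ∈ (FreeGroup.lift a).range := by
      rw [FreeGroup.range_lift_eq_closure, hgen]; trivial
    obtain ⟨w, hw⟩ := h1
    exact ⟨QuotientGroup.mk w, hw⟩
  have hne : ∃ i, s i ≠ 1 := by
    by_contra hcon
    push Not at hcon
    have : Set.range a ⊆ {1} := by
      rintro _ ⟨i, rfl⟩
      rw [Set.mem_singleton_iff, ← hps i, hcon i, map_one]
    have h2 : (⊤ : Subgroup G) ≤ ⊥ := by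
      rw [← hgen, Subgroup.closure_le]
      simpa using this
    obtain ⟨x, hx⟩ := exists_ne (1:G)
    exact hx (by simpa using h2 (Subgroup.mem_top x))
  obtain ⟨i0, hi0⟩ := hne
  obtain ⟨c, C, hV⟩ := volB_of_polyGrowth a hgen hpoly
  have hD := D_pos a hgen hV
  obtain ⟨K, hK1, hK⟩ := hV.doubling a
  obtain ⟨R0, hR01, hgood⟩ := exists_good_radius a hK
  obtain ⟨hc, hC, hvol⟩ := hV
  have hr2 : (2:ℝ) ≤ r := by exact_mod_cast hr
  set ε : ℝ := 1/(8192*r*K^2) with hεdef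
  have hε : 0 < ε := by positivity
  have hε1 : ε ≤ 1 := by
    rw [hεdef, div_le_one (by positivity)]
    nlinarith
  set d : ℝ := c/(16*(2+D)) with hddef
  have hd : 0 < d := by positivity
  set e : ℝ := min (ε/16) (d/2) with hedef
  have he : 0 < e := lt_min (by positivity) (by positivity)
  have hev : ∀ X : ℝ, ∀ᶠ n in Filter.atTop, X ≤ scl D n :=
    fun X => (scl_tendsto D).eventually_ge_atTop X
  have hall := (hev 9).and ((hev (2*K)).and ((hev R0).and ((hev (15116544^2)).and
    ((hev (2*(C+4*D)/d)).and ((hev (2/e)).and (Filter.eventually_ge_atTop 3))))))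
  obtain ⟨n0, hn0⟩ := Filter.eventually_atTop.1 hall
  refine finish_const (fun n => ((avgL s)^(2*n)) (dl 1) 1) (phiF D) (fun n hn => phiF_pos D hn)
    (fun n _ => return_pos s _) (fun n hn => ?_) (4*K+4+(1+3*r)*(C*2^D)) (e/2) (by positivity)
    (by positivity) n0 (fun n hn => ?_) (fun n hn => ?_)
  · have := return_lt_one s i0 hi0 (2*n-1)
    rwa [show 2*n-1+1 = 2*n by omega] at this
  · obtain ⟨h9, h2K, hR0, hA, h5, h6, h3⟩ := hn0 n hn
    have hx0 : 0 ≤ scl D n := by linarith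
    have hceil1 : scl D n ≤ (⌈scl D n⌉₊ : ℝ) := Nat.le_ceil _
    have hceil2 := (Nat.ceil_lt_add_one hx0).le
    set R := ⌈scl D n⌉₊ with hR
    have hR9 : 9 ≤ R := by
      have : (9:ℝ) ≤ R := by linarith
      exact_mod_cast this
    refine lower_asym (R := R) (V := (wBall a (R+1)).card) h3 hK1 hC (return_pos s _).le
      (by linarith) h2K hceil1 hceil2 (hvol (R+1) (by omega)).2 ?_
    exact lower_main a s (projM a) (by omega) hps hsurj (projM_comm a) hK1 hK R (by omega)
      (by nlinarith) n
  · obtain ⟨h9, h2K, hR0, hA, h5, h6, h3⟩ := hn0 n hn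
    have hx0 : 0 ≤ scl D n := by linarith
    have hceil1 : scl D n ≤ (⌈scl D n⌉₊ : ℝ) := Nat.le_ceil _
    have hceil2 := (Nat.ceil_lt_add_one hx0).le
    set R := ⌈scl D n⌉₊ with hR
    have hR9 : 9 ≤ R := by
      have : (9:ℝ) ≤ R := by linarith
      exact_mod_cast this
    have hRR0 : R0 ≤ R := by
      have : (R0:ℝ) ≤ R := by linarith
      exact_mod_cast this
    obtain ⟨R', hR1, hR2, hgr⟩ := hgood R hRR0
    have hR1' : (R:ℝ) ≤ R' := by exact_mod_cast hR1
    have hR2' : (R':ℝ)+1 ≤ 2*R := by exact_mod_cast hR2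
    refine upper_asym (m := R'+1) (V := (wBall a (2*n+(R'+1))).card)
      (q := ((wBall a (R'+1)).card+3)/4) (A := 15116544) (ε := ε) (c := c) (C := C) h3 hD hε hε1 hc hC
      (by norm_num) (by linarith) hA hddef h5 he (min_le_left _ _) (min_le_right _ _) h6
      (by push_cast; linarith) (by push_cast; linarith) (hvol _ (by omega)).2 ?_
      (upper_main a hr R' n hK1 hK (by omega) hgr)
    have h7 := (hvol (R'+1) (by omega)).1
    have h8 : (wBall a (R'+1)).card ≤ 4 * (((wBall a (R'+1)).card+3)/4) := by omega
    have h8' : ((wBall a (R'+1)).card : ℝ) ≤ 4 * ((((wBall a (R'+1)).card+3)/4 : ℕ) : ℝ) := by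
      exact_mod_cast h8
    linarith


end part9

/-- Theorem: let `G` be an infinite polycyclic group of polynomial volume growth of degree
`D` with a polycyclic series `G = G₁ ⊳ … ⊳ G_{r+1} = {e}` (`r ≥ 2`) and associated standard
polycyclic presentation `G = F_r/N`. The lazy simple random walk on `Γ₂(N) = F_r/[N,N]`
satisfies `μ^{(2n)}(e) ≍ exp(− n^{D/(2+D)} (log n)^{2/(2+D)})`. -/
theorem return_probability_polycyclic_polynomial_cover
    {G : Type*} [Group G] [Infinite G] (r : ℕ) (hr : 2 ≤ r)
    (H : Fin (r + 1) → Subgroup G)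
    (htop : H 0 = ⊤) (hbot : H (Fin.last r) = ⊥)
    (a : Fin r → G) (ha : ∀ i : Fin r, a i ∈ H i.castSucc)
    (hnormal : ∀ i : Fin r, ∀ g ∈ H i.castSucc, ∀ x ∈ H i.succ, g * x * g⁻¹ ∈ H i.succ)
    (hcyclic : ∀ i : Fin r, ∀ g ∈ H i.castSucc, ∃ n : ℤ, ((a i) ^ n)⁻¹ * g ∈ H i.succ)
    (D : ℕ) (hpoly : HasPolyGrowth G D) :
    ∃ C : ℝ, 1 ≤ C ∧ ∀ n : ℕ, 2 ≤ n →
      Real.exp (-C * (n : ℝ) ^ ((D : ℝ) / (2 + (D : ℝ))) *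
          (Real.log n) ^ ((2 : ℝ) / (2 + (D : ℝ))))
        ≤ convPow (lazySRWQuot r ⁅(FreeGroup.lift a).ker, (FreeGroup.lift a).ker⁆) (2 * n) 1 ∧
      convPow (lazySRWQuot r ⁅(FreeGroup.lift a).ker, (FreeGroup.lift a).ker⁆) (2 * n) 1
        ≤ Real.exp (-(1 / C) * (n : ℝ) ^ ((D : ℝ) / (2 + (D : ℝ))) *
          (Real.log n) ^ ((2 : ℝ) / (2 + (D : ℝ)))) := by
  classical
  obtain ⟨C, hC, h⟩ := main_asym r hr a (closure_of_series r H htop hbot a hcyclic) D hpoly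
  refine ⟨C, hC, fun n hn => ?_⟩
  have h1 := h n hn
  rw [convPow_eq_avgL]
  unfold phiF at h1
  refine ⟨le_trans (le_of_eq ?_) h1.1, le_trans h1.2 (le_of_eq ?_)⟩
  · congr 1; ring
  · congr 1; ring

end
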